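/- Assume I_{ε,r} > −1. Let X be the number of good vertices of 𝔾(n,p₂,p₃). Then E[X²] = (1+o(1))·E[X]² as n → ∞, i.e. the ratio E[X²]/E[X]² tends to 1. -/

import Mathlib

open MeasureTheory Real Filter ENNReal

/-- Bernoulli-type measure on `Bool` with success probability `p`. -/
noncomputable def bern (p : ℝ) : Measure Bool :=
  (ENNReal.ofReal p) • Measure.dirac true + (ENNReal.ofReal (1 - p)) • Measure.dirac false

instance bern_finite (p : ℝ) : IsFiniteMeasure (bern p) := by
  constructor
  simp only [bern, Measure.coe_add, Measure.coe_smul, Pi.add_apply, Pi.smul_apply,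
    smul_eq_mul]
  finiteness

/-- Index type of potential edges: subsets of size 2 or 3. -/
abbrev EdgeIdx (n : ℕ) := {e : Finset (Fin n) // e.card = 2 ∨ e.card = 3}

/-- The law of the random hypergraph `𝔾(n, p₂, p₃)` with `p₂ = (1-ε)/n` and
`p₃ = r/(n ln n)`: the product of Bernoulli measures over all 2- and 3-subsets. -/
noncomputable def hypMeasure (n : ℕ) (ε r : ℝ) : Measure (EdgeIdx n → Bool) :=
  Measure.pi fun e =>
    bern (if e.1.card = 2 then (1 - ε) / n else r / (n * Real.log n))

/-- `e` is an edge of the configuration `ω`. -/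
def IsEdge {n : ℕ} (ω : EdgeIdx n → Bool) (e : Finset (Fin n)) : Prop :=
  ∃ h : e.card = 2 ∨ e.card = 3, ω ⟨e, h⟩ = true

/-- The constant `I_{ε,r} = -(1/r)(ε - ε²/2 + (1-ε)ln(1-ε))`. -/
noncomputable def Ier (ε r : ℝ) : ℝ :=
  -(1 / r) * (ε - ε ^ 2 / 2 + (1 - ε) * Real.log (1 - ε))

/-- The constant `K₀ = max {1, 2(9+ε)/r}`. -/
noncomputable def K0 (ε r : ℝ) : ℝ := max 1 (2 * (9 + ε) / r)

/-- `f 0, …, f (k-1)` is a propagation sequence from the vertex set `S`: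
every `f l` is an edge and meets `S ∪ f 0 ∪ ⋯ ∪ f (l-1)` in all but exactly
one vertex. -/
def IsPropSeqFrom {n : ℕ} (ω : EdgeIdx n → Bool) (S : Finset (Fin n))
    (k : ℕ) (f : ℕ → Finset (Fin n)) : Prop :=
  (∀ i < k, IsEdge ω (f i)) ∧
  ∀ l < k, (f l ∩ (S ∪ (Finset.range l).biUnion f)).card = (f l).card - 1

/-- The propagation component of the vertex set `S`: the union of `S` with all
edges occurring in propagation sequences from `S`. -/
def propComponent {n : ℕ} (ω : EdgeIdx n → Bool) (S : Finset (Fin n)) : Set (Fin n) :=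
  ↑S ∪ {x | ∃ k f, IsPropSeqFrom ω S k f ∧ ∃ i < k, x ∈ f i}

/-- The number of good vertices: vertices whose propagation component has at
least `K₀ ln n` vertices. -/
noncomputable def goodCount (n : ℕ) (ε r : ℝ) (ω : EdgeIdx n → Bool) : ℕ :=
  Set.ncard {v : Fin n | K0 ε r * Real.log n ≤ ((propComponent ω {v}).ncard : ℝ)}

open ProbabilityTheory

/-! ### Products of Bernoulli measures -/

section BernoulliProduct

lemma isProbabilityMeasure_bern {q : ℝ} (h0 : 0 ≤ q) (h1 : q ≤ 1) :
    IsProbabilityMeasure (bern q) := by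
  constructor
  simp only [bern, Measure.coe_add, Measure.coe_smul, Pi.add_apply, Pi.smul_apply,
    smul_eq_mul, measure_univ, mul_one]
  rw [← ENNReal.ofReal_add h0 (by linarith)]
  simp

lemma bern_real_true {q : ℝ} (h0 : 0 ≤ q) : (bern q).real {true} = q := by
  simp [bern, measureReal_def, h0]

lemma bern_real_false {q : ℝ} (h1 : q ≤ 1) : (bern q).real {false} = 1 - q := by
  simp [bern, measureReal_def, h1]

variable {ι : Type*}

/-- Membership in `A` is determined by the coordinates in `S`. -/
def DeterminedBy (A : Set (ι → Bool)) (S : Set ι) : Prop :=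
  ∀ ⦃ω ω' : ι → Bool⦄, (∀ i ∈ S, ω i = ω' i) → ω ∈ A → ω' ∈ A

lemma determinedBy_biInter {κ : Type*} {U : Finset κ} {A : κ → Set (ι → Bool)} {F : κ → Set ι}
    {S : Set ι} (hA : ∀ x ∈ U, DeterminedBy (A x) (F x)) (hF : ∀ x ∈ U, F x ⊆ S) :
    DeterminedBy (⋂ x ∈ U, A x) S := by
  intro ω ω' hω h
  simp only [Set.mem_iInter] at h ⊢
  exact fun x hx => hA x hx (fun i hi => hω i (hF x hx hi)) (h x hx)

variable [Fintype ι] {p : ι → ℝ}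

/-- The product of Bernoulli measures with success probabilities `p i`. -/
noncomputable def bernPi (p : ι → ℝ) : Measure (ι → Bool) := Measure.pi fun i => bern (p i)

lemma isProbabilityMeasure_bernPi (hp : ∀ i, p i ∈ Set.Icc (0 : ℝ) 1) :
    IsProbabilityMeasure (bernPi p) := by
  have := fun i => isProbabilityMeasure_bern (hp i).1 (hp i).2
  unfold bernPi
  infer_instance

lemma bernPi_real_inter (hp : ∀ i, p i ∈ Set.Icc (0 : ℝ) 1) {A B : Set (ι → Bool)} {S T : Set ι}
    (hA : DeterminedBy A S) (hB : DeterminedBy B T) (hST : Disjoint S T) :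
    (bernPi p).real (A ∩ B) = (bernPi p).real A * (bernPi p).real B := by
  classical
  have := fun i => isProbabilityMeasure_bern (hp i).1 (hp i).2
  have hind : iIndepFun (fun i (ω : ι → Bool) => ω i) (bernPi p) :=
    iIndepFun_pi (X := fun _ x => x) fun i => aemeasurable_id
  have h := hind.indepFun_finset S.toFinset T.toFinset
    (by simpa [Set.disjoint_toFinset] using hST) (fun i => measurable_pi_apply i)
  have key : ∀ {C : Set (ι → Bool)} {R : Set ι}, DeterminedBy C R →
      C = (fun (ω : ι → Bool) (i : R.toFinset) => ω i) ⁻¹'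
        ((fun (ω : ι → Bool) (i : R.toFinset) => ω i) '' C) := by
    intro C R hC
    refine Set.Subset.antisymm (Set.subset_preimage_image _ _) ?_
    rintro ω ⟨ω', h', he⟩
    exact hC (fun i hi => congrFun he ⟨i, by simpa using hi⟩) h'
  rw [measureReal_def, measureReal_def, measureReal_def, ← ENNReal.toReal_mul]
  congr 1
  conv_lhs => rw [key hA, key hB]
  rw [h.measure_inter_preimage_eq_mul _ _ .of_discrete .of_discrete, ← key hA, ← key hB]

lemma bernPi_real_true (hp : ∀ i, p i ∈ Set.Icc (0 : ℝ) 1) (i : ι) :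
    (bernPi p).real {ω | ω i = true} = p i := by
  have := fun i => isProbabilityMeasure_bern (hp i).1 (hp i).2
  have h : {ω : ι → Bool | ω i = true} = (fun ω => ω i) ⁻¹' ({true} : Set Bool) := by ext; simp
  rw [h, measureReal_def, bernPi,
    (measurePreserving_eval (fun i => bern (p i)) i).measure_preimage
      MeasurableSet.of_discrete.nullMeasurableSet,
    ← measureReal_def, bern_real_true (hp i).1]

lemma bernPi_real_false (hp : ∀ i, p i ∈ Set.Icc (0 : ℝ) 1) (i : ι) :
    (bernPi p).real {ω | ω i = false} = 1 - p i := by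
  have := fun i => isProbabilityMeasure_bern (hp i).1 (hp i).2
  have h : {ω : ι → Bool | ω i = false} = (fun ω => ω i) ⁻¹' ({false} : Set Bool) := by ext; simp
  rw [h, measureReal_def, bernPi,
    (measurePreserving_eval (fun i => bern (p i)) i).measure_preimage
      MeasurableSet.of_discrete.nullMeasurableSet,
    ← measureReal_def, bern_real_false (hp i).2]

lemma bernPi_real_biInter (hp : ∀ i, p i ∈ Set.Icc (0 : ℝ) 1) {κ : Type*} (U : Finset κ)
    {A : κ → Set (ι → Bool)} {F : κ → Set ι} (hA : ∀ x ∈ U, DeterminedBy (A x) (F x))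
    (hF : (U : Set κ).PairwiseDisjoint F) :
    (bernPi p).real (⋂ x ∈ U, A x) = ∏ x ∈ U, (bernPi p).real (A x) := by
  classical
  have := isProbabilityMeasure_bernPi hp
  induction U using Finset.induction_on with
  | empty => simp
  | insert a U ha ih =>
    rw [Finset.set_biInter_insert, Finset.prod_insert ha,
      ← ih (fun x hx => hA x (Finset.mem_insert_of_mem hx))
        (hF.subset (by simp [Finset.coe_insert]))]
    refine bernPi_real_inter hp (hA a (Finset.mem_insert_self a U))
      (determinedBy_biInter (F := F) (S := ⋃ x ∈ U, F x)
        (fun x hx => hA x (Finset.mem_insert_of_mem hx))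
        (fun x hx => Set.subset_biUnion_of_mem (u := F) hx)) ?_
    rw [Set.disjoint_iUnion₂_right]
    intro x hx
    exact hF (by simp) (by simp [hx]) (fun h => ha (h ▸ hx))

lemma bernPi_real_forall_false (hp : ∀ i, p i ∈ Set.Icc (0 : ℝ) 1) (F : Finset ι) :
    (bernPi p).real {ω | ∀ i ∈ F, ω i = false} = ∏ i ∈ F, (1 - p i) := by
  have h : {ω : ι → Bool | ∀ i ∈ F, ω i = false} = ⋂ i ∈ F, {ω | ω i = false} := by
    ext; simp
  rw [h, bernPi_real_biInter hp F (F := fun i => {i})]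
  · exact Finset.prod_congr rfl fun i _ => bernPi_real_false hp i
  · intro i _ ω ω' hω h
    have := hω i rfl
    simp_all
  · intro i _ j _ hij
    simpa using hij

lemma bernPi_real_exists_true (hp : ∀ i, p i ∈ Set.Icc (0 : ℝ) 1) (F : Finset ι) :
    (bernPi p).real {ω | ∃ i ∈ F, ω i = true} = 1 - ∏ i ∈ F, (1 - p i) := by
  have := isProbabilityMeasure_bernPi hp
  rw [← bernPi_real_forall_false hp F, ← probReal_compl_eq_one_sub .of_discrete]
  congr 1
  ext; simp

/-- An event that is stable under switching off the coordinate `i` is negatively correlated with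
the coordinate `i` being on. -/
lemma bernPi_real_inter_true_le (hp : ∀ i, p i ∈ Set.Icc (0 : ℝ) 1) [DecidableEq ι] (i : ι)
    {A : Set (ι → Bool)} (hA : ∀ ω ∈ A, Function.update ω i false ∈ A) :
    (bernPi p).real (A ∩ {ω | ω i = true}) ≤ p i * (bernPi p).real A := by
  have := isProbabilityMeasure_bernPi hp
  set B : Set (ι → Bool) := {ω | Function.update ω i true ∈ A} with hB
  have hBA : B ⊆ A := by
    intro ω h
    rcases hω : ω i with _ | _
    · have := hA _ h
      rwa [Function.update_idem, ← hω, Function.update_eq_self] at this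
    · rwa [hB, Set.mem_ofPred_eq, ← hω, Function.update_eq_self] at h
  have hAB : A ∩ {ω | ω i = true} = {ω | ω i = true} ∩ B := by
    ext ω
    constructor
    · rintro ⟨h, hi⟩
      refine ⟨hi, ?_⟩
      have hi' : ω i = true := hi
      rwa [hB, Set.mem_ofPred_eq, ← hi', Function.update_eq_self]
    · rintro ⟨hi, h⟩
      exact ⟨hBA h, hi⟩
  rw [hAB, bernPi_real_inter hp (S := {i}) (T := {i}ᶜ), bernPi_real_true hp]
  · exact mul_le_mul_of_nonneg_left (measureReal_mono hBA) (hp i).1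
  · intro ω ω' hω h
    have := hω i rfl
    simp_all
  · intro ω ω' hω h
    have : Function.update ω' i true = Function.update ω i true := by
      ext j
      by_cases hj : j = i
      · subst hj; simp
      · simp [hj, hω j hj]
    simpa [hB, this] using h
  · exact disjoint_compl_right

end BernoulliProduct

/-! ### Step-by-step exploration of a propagation component -/

section Exploration

variable {n : ℕ} {ω ω' : EdgeIdx n → Bool} {S T A : Finset (Fin n)} {v : Fin n}

open Classical in
/-- The vertices outside `S` that one propagation step adds to `S`. -/
noncomputable def addable (ω : EdgeIdx n → Bool) (S : Finset (Fin n)) : Finset (Fin n) :=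
  {x | x ∉ S ∧ ∃ e, IsEdge ω e ∧ x ∈ e ∧ e.erase x ⊆ S}

lemma mem_addable {x : Fin n} :
    x ∈ addable ω S ↔ x ∉ S ∧ ∃ e, IsEdge ω e ∧ x ∈ e ∧ e.erase x ⊆ S := by
  simp [addable]

/-- Adjoin the least addable vertex, if there is one. -/
noncomputable def grow (ω : EdgeIdx n → Bool) (S : Finset (Fin n)) : Finset (Fin n) :=
  if h : (addable ω S).Nonempty then insert ((addable ω S).min' h) S else S

/-- The vertices found from `v` within `i` exploration steps. -/
noncomputable def explore (ω : EdgeIdx n → Bool) (v : Fin n) (i : ℕ) : Finset (Fin n) :=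
  (grow ω)^[i] {v}

/-- The propagation component of `v`, as a finset. -/
noncomputable def component (ω : EdgeIdx n → Bool) (v : Fin n) : Finset (Fin n) :=
  explore ω v n

@[simp] lemma explore_zero : explore ω v 0 = {v} := rfl

lemma explore_succ (i : ℕ) : explore ω v (i + 1) = grow ω (explore ω v i) :=
  Function.iterate_succ_apply' _ _ _

lemma subset_grow : S ⊆ grow ω S := by
  unfold grow
  split_ifs
  · exact Finset.subset_insert _ _
  · exact subset_rfl

lemma explore_mono : Monotone (explore ω v) :=
  monotone_nat_of_le_succ fun i => by rw [explore_succ]; exact subset_grow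

lemma self_mem_explore (i : ℕ) : v ∈ explore ω v i :=
  explore_mono (Nat.zero_le i) (by simp)

lemma grow_of_addable_eq_empty (h : addable ω S = ∅) : grow ω S = S := by
  simp [grow, h]

lemma card_grow (h : (addable ω S).Nonempty) : (grow ω S).card = S.card + 1 := by
  rw [grow, dif_pos h, Finset.card_insert_of_notMem]
  exact (mem_addable.1 (Finset.min'_mem _ h)).1

lemma addable_explore_eq_empty_or (i : ℕ) :
    (addable ω (explore ω v i) = ∅ ∧ (explore ω v i).card ≤ i + 1) ∨
      (explore ω v i).card = i + 1 := by
  induction i with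
  | zero => right; simp
  | succ i ih =>
    rcases Finset.eq_empty_or_nonempty (addable ω (explore ω v i)) with h | h
    · left
      rw [explore_succ, grow_of_addable_eq_empty h]
      exact ⟨h, by rcases ih with ih | ih <;> omega⟩
    · right
      rw [explore_succ, card_grow h]
      rcases ih with ih | ih
      · exact absurd ih.1 h.ne_empty
      · omega

lemma addable_component : addable ω (component ω v) = ∅ := by
  rcases addable_explore_eq_empty_or (ω := ω) (v := v) n with h | h
  · exact h.1
  · have := Finset.card_le_univ (explore ω v n)
    rw [Fintype.card_fin] at this
    omega

lemma mem_of_addable_eq_empty (hT : addable ω T = ∅) {e : Finset (Fin n)} {x : Fin n}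
    (he : IsEdge ω e) (hx : x ∈ e) (h : e.erase x ⊆ T) : x ∈ T := by
  by_contra hxT
  have : x ∈ addable ω T := mem_addable.2 ⟨hxT, e, he, hx, h⟩
  simp [hT] at this

lemma explore_subset (hv : v ∈ T) (hT : addable ω T = ∅) (i : ℕ) : explore ω v i ⊆ T := by
  induction i with
  | zero => simpa using hv
  | succ i ih =>
    rw [explore_succ, grow]
    split_ifs with h
    · obtain ⟨-, e, he, hx, hs⟩ := mem_addable.1 (Finset.min'_mem _ h)
      exact Finset.insert_subset (mem_of_addable_eq_empty hT he hx (hs.trans ih)) ih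
    · exact ih

lemma self_mem_component : v ∈ component ω v := self_mem_explore n

lemma explore_subset_component (i : ℕ) : explore ω v i ⊆ component ω v :=
  explore_subset self_mem_component addable_component i

lemma le_card_component_iff {k : ℕ} (hk : 1 ≤ k) :
    k ≤ (component ω v).card ↔ (explore ω v (k - 1)).card = k := by
  constructor
  · intro h
    rcases addable_explore_eq_empty_or (ω := ω) (v := v) (k - 1) with h' | h'
    · have := Finset.card_le_card (explore_subset (self_mem_explore _) h'.1 n)
      rw [← component] at this
      omega
    · omega
  · intro h
    exact h.symm.le.trans (Finset.card_le_card (explore_subset_component _))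

lemma card_inter_of_erase_subset {e : Finset (Fin n)} {x : Fin n} (hx : x ∈ e) (hxS : x ∉ S)
    (h : e.erase x ⊆ S) : (e ∩ S).card = e.card - 1 := by
  rw [← Finset.card_erase_of_mem hx]
  congr 1
  ext y
  simp only [Finset.mem_inter, Finset.mem_erase]
  constructor
  · rintro ⟨h1, h2⟩
    exact ⟨fun h => hxS (h ▸ h2), h1⟩
  · rintro ⟨h1, h2⟩
    exact ⟨h2, h (Finset.mem_erase.2 ⟨h1, h2⟩)⟩

lemma exists_isPropSeqFrom_explore (ω : EdgeIdx n → Bool) (v : Fin n) (i : ℕ) :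
    ∃ k f, IsPropSeqFrom ω {v} k f ∧
      explore ω v i = {v} ∪ (Finset.range k).biUnion f := by
  induction i with
  | zero => exact ⟨0, fun _ => ∅, ⟨by simp, by simp⟩, by simp⟩
  | succ i ih =>
    obtain ⟨k, f, hf, hS⟩ := ih
    rcases Finset.eq_empty_or_nonempty (addable ω (explore ω v i)) with h | h
    · exact ⟨k, f, hf, by rw [explore_succ, grow_of_addable_eq_empty h, hS]⟩
    · have hmem := Finset.min'_mem _ h
      have hgrow : explore ω v (i + 1) =
          insert ((addable ω (explore ω v i)).min' h) (explore ω v i) := by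
        rw [explore_succ, grow, dif_pos h]
      generalize (addable ω (explore ω v i)).min' h = x at hmem hgrow
      obtain ⟨hxS, e, he, hx, hs⟩ := mem_addable.1 hmem
      have hu : ∀ l ≤ k, (Finset.range l).biUnion (Function.update f k e) =
          (Finset.range l).biUnion f := by
        intro l hl
        refine Finset.biUnion_congr rfl fun j hj => ?_
        rw [Function.update_of_ne]
        have := Finset.mem_range.1 hj
        omega
      refine ⟨k + 1, Function.update f k e, ⟨?_, ?_⟩, ?_⟩
      · intro j hj
        rcases eq_or_ne j k with rfl | hjk
        · simpa using he
        · rw [Function.update_of_ne hjk]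
          exact hf.1 j (by omega)
      · intro l hl
        rw [hu l (by omega)]
        rcases eq_or_ne l k with rfl | hlk
        · rw [Function.update_self, ← hS]
          exact card_inter_of_erase_subset hx hxS hs
        · rw [Function.update_of_ne hlk]
          exact hf.2 l (by omega)
      · rw [hgrow, Finset.range_add_one, Finset.biUnion_insert, hu k le_rfl, Function.update_self,
          Finset.union_left_comm, ← hS]
        ext y
        simp only [Finset.mem_insert, Finset.mem_union]
        constructor
        · rintro (rfl | h)
          · exact Or.inl hx
          · exact Or.inr h
        · rintro (h | h)
          · by_cases hy : y = x
            · exact Or.inl hy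
            · exact Or.inr (hs (Finset.mem_erase.2 ⟨hy, h⟩))
          · exact Or.inr h

lemma IsPropSeqFrom.subset_component {k : ℕ} {f : ℕ → Finset (Fin n)}
    (hf : IsPropSeqFrom ω {v} k f) :
    ∀ l ≤ k, {v} ∪ (Finset.range l).biUnion f ⊆ component ω v := by
  intro l
  induction l with
  | zero => intro _; simpa using self_mem_component
  | succ l ih =>
    intro hl
    have ih := ih (by omega)
    have he := hf.1 l (by omega)
    have hc := hf.2 l (by omega)
    set P := {v} ∪ (Finset.range l).biUnion f
    have hpos : 1 ≤ (f l).card := by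
      obtain ⟨h, -⟩ := he
      omega
    have h1 : (f l \ P).card = 1 := by
      have := Finset.card_sdiff_add_card_inter (f l) P
      omega
    obtain ⟨x, hx⟩ := Finset.card_eq_one.1 h1
    have hxf : x ∈ f l \ P := by simp [hx]
    have hs : (f l).erase x ⊆ component ω v := by
      intro y hy
      rw [Finset.mem_erase] at hy
      by_contra hyC
      have : y ∈ f l \ P := Finset.mem_sdiff.2 ⟨hy.2, fun h => hyC (ih h)⟩
      rw [hx, Finset.mem_singleton] at this
      exact hy.1 this
    have hxC := mem_of_addable_eq_empty addable_component he (Finset.mem_sdiff.1 hxf).1 hs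
    rw [Finset.range_add_one, Finset.biUnion_insert, Finset.union_left_comm]
    refine Finset.union_subset (fun y hy => ?_) ih
    by_cases hyx : y = x
    · exact hyx ▸ hxC
    · exact hs (Finset.mem_erase.2 ⟨hyx, hy⟩)

lemma propComponent_singleton (ω : EdgeIdx n → Bool) (v : Fin n) :
    propComponent ω {v} = component ω v := by
  ext x
  simp only [propComponent, Set.mem_union, Finset.mem_coe]
  constructor
  · rintro (h | ⟨k, f, hf, i, hi, hx⟩)
    · rw [Finset.mem_singleton.1 h]
      exact self_mem_component
    · refine hf.subset_component k le_rfl (Finset.mem_union_right _ ?_)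
      exact Finset.mem_biUnion.2 ⟨i, Finset.mem_range.2 hi, hx⟩
  · intro hx
    obtain ⟨k, f, hf, hS⟩ := exists_isPropSeqFrom_explore ω v n
    rw [component, hS, Finset.mem_union] at hx
    rcases hx with h | h
    · exact Or.inl h
    · obtain ⟨i, hi, hx⟩ := Finset.mem_biUnion.1 h
      exact Or.inr ⟨k, f, hf, i, Finset.mem_range.1 hi, hx⟩

lemma two_le_card_of_isEdge {e : Finset (Fin n)} (he : IsEdge ω e) : 2 ≤ e.card := by
  obtain ⟨h, -⟩ := he
  omega

lemma erase_nonempty_of_isEdge {e : Finset (Fin n)} {x : Fin n} (he : IsEdge ω e) (hx : x ∈ e) :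
    (e.erase x).Nonempty := by
  have := two_le_card_of_isEdge he
  rw [← Finset.card_pos, Finset.card_erase_of_mem hx]
  omega

/-- If an exploration ends with `A`, then it still does after deleting edges not contained in `A`
and arbitrary changes to edges disjoint from `A`. -/
lemma explore_eq_of_edges {i : ℕ} (hA : explore ω v i = A)
    (h₁ : ∀ e, IsEdge ω' e → ¬ Disjoint e A → IsEdge ω e)
    (h₂ : ∀ e, IsEdge ω e → e ⊆ A → IsEdge ω' e) : explore ω' v i = A := by
  suffices h : ∀ j ≤ i, explore ω' v j = explore ω v j by rw [h i le_rfl, hA]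
  intro j
  induction j with
  | zero => intro _; rfl
  | succ j ih =>
    intro hj
    have hSA : explore ω v j ⊆ A := hA ▸ explore_mono (by omega)
    have hSA' : explore ω v (j + 1) ⊆ A := hA ▸ explore_mono hj
    rw [explore_succ, explore_succ, ih (by omega)]
    rw [explore_succ] at hSA'
    generalize explore ω v j = S at *
    have hsub : addable ω' S ⊆ addable ω S := by
      intro x hx
      obtain ⟨hxS, e, he, hxe, hs⟩ := mem_addable.1 hx
      refine mem_addable.2 ⟨hxS, e, h₁ e he ?_, hxe, hs⟩
      obtain ⟨y, hy⟩ := erase_nonempty_of_isEdge he hxe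
      exact Finset.not_disjoint_iff.2 ⟨y, Finset.mem_of_mem_erase hy, hSA (hs hy)⟩
    rcases Finset.eq_empty_or_nonempty (addable ω S) with h | h
    · rw [grow_of_addable_eq_empty h, grow_of_addable_eq_empty]
      exact Finset.subset_empty.1 (h ▸ hsub)
    · have hmem := Finset.min'_mem _ h
      have hmin : (addable ω S).min' h ∈ addable ω' S := by
        have hxA : (addable ω S).min' h ∈ A := by
          refine hSA' ?_
          rw [grow, dif_pos h]
          exact Finset.mem_insert_self _ _
        obtain ⟨hxS, e, he, hxe, hs⟩ := mem_addable.1 hmem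
        refine mem_addable.2 ⟨hxS, e, h₂ e he ?_, hxe, hs⟩
        rw [← Finset.insert_erase hxe]
        exact Finset.insert_subset hxA (hs.trans hSA)
      have h' : (addable ω' S).Nonempty := ⟨_, hmin⟩
      rw [grow, grow, dif_pos h, dif_pos h']
      congr 1
      exact le_antisymm (Finset.min'_le _ _ hmin) (Finset.min'_le _ _ (hsub (Finset.min'_mem _ h')))

/-- Delete all edges meeting `A`. -/
def deleteMeeting (A : Finset (Fin n)) (ω : EdgeIdx n → Bool) : EdgeIdx n → Bool :=
  fun e => ω e && decide (Disjoint e.1 A)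

lemma isEdge_deleteMeeting {e : Finset (Fin n)} :
    IsEdge (deleteMeeting A ω) e ↔ IsEdge ω e ∧ Disjoint e A := by
  simp only [IsEdge, deleteMeeting, Bool.and_eq_true, decide_eq_true_eq]
  exact ⟨fun ⟨h, h1, h2⟩ => ⟨⟨h, h1⟩, h2⟩, fun ⟨⟨h, h1⟩, h2⟩ => ⟨h, h1, h2⟩⟩

lemma disjoint_component_deleteMeeting (hv : v ∉ A) :
    Disjoint (component (deleteMeeting A ω) v) A := by
  have : component (deleteMeeting A ω) v ⊆ Aᶜ := by
    refine explore_subset (by simpa using hv) ?_ n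
    rw [Finset.eq_empty_iff_forall_notMem]
    intro x hx
    obtain ⟨hxA, e, he, hxe, -⟩ := mem_addable.1 hx
    exact Finset.disjoint_left.1 (isEdge_deleteMeeting.1 he).2 hxe (by simpa using hxA)
  exact Finset.disjoint_left.2 fun x hx => Finset.mem_compl.1 (this hx)

lemma component_deleteMeeting_subset :
    component (deleteMeeting A ω) v ⊆ component ω v := by
  refine explore_subset self_mem_component ?_ n
  rw [Finset.eq_empty_iff_forall_notMem]
  intro x hx
  obtain ⟨hxC, e, he, hxe, hs⟩ := mem_addable.1 hx
  exact hxC (mem_of_addable_eq_empty addable_component (isEdge_deleteMeeting.1 he).1 hxe hs)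

/-- If deleting the edges meeting `A` makes the component of `v` smaller, then some edge leads
from the smaller component into `A`. -/
lemma exists_edge_into (hv : v ∉ A)
    (h : (component (deleteMeeting A ω) v).card < (component ω v).card) :
    ∃ a ∈ A, ∃ e, IsEdge ω e ∧ a ∈ e ∧ e.erase a ⊆ component (deleteMeeting A ω) v := by
  by_contra! hcon
  refine absurd h (not_lt.2 (Finset.card_le_card (explore_subset self_mem_component ?_ n)))
  rw [Finset.eq_empty_iff_forall_notMem]
  intro x hx
  obtain ⟨hxC, e, he, hxe, hs⟩ := mem_addable.1 hx
  have hxA : x ∉ A := fun hxA => hcon x hxA e he hxe hs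
  refine hxC (mem_of_addable_eq_empty addable_component
    (isEdge_deleteMeeting.2 ⟨he, ?_⟩) hxe hs)
  rw [← Finset.insert_erase hxe, Finset.disjoint_insert_left]
  exact ⟨hxA, Finset.disjoint_of_subset_left hs (disjoint_component_deleteMeeting hv)⟩

end Exploration

/-! ### Upper bound on the second moment -/

section SecondMoment

variable {n : ℕ} {p₂ p₃ : ℝ} {k : ℕ} {A B : Finset (Fin n)} {u v : Fin n}

/-- The probability of an edge: `p₂` for pairs and `p₃` for triples. -/
noncomputable def edgeProb (n : ℕ) (p₂ p₃ : ℝ) (e : EdgeIdx n) : ℝ :=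
  if e.1.card = 2 then p₂ else p₃

lemma edgeProb_mem_Icc (h₂ : p₂ ∈ Set.Icc (0 : ℝ) 1) (h₃ : p₃ ∈ Set.Icc (0 : ℝ) 1)
    (e : EdgeIdx n) : edgeProb n p₂ p₃ e ∈ Set.Icc (0 : ℝ) 1 := by
  unfold edgeProb
  split_ifs <;> assumption

/-- The propagation component of `v` has at least `k` vertices. -/
def largeComponent (k : ℕ) (v : Fin n) : Set (EdgeIdx n → Bool) :=
  {ω | k ≤ (component ω v).card}

lemma isEdge_congr {ω ω' : EdgeIdx n → Bool} {S : Set (EdgeIdx n)} (h : ∀ i ∈ S, ω i = ω' i)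
    {e : Finset (Fin n)} (he : IsEdge ω e) (heS : ∀ h, (⟨e, h⟩ : EdgeIdx n) ∈ S) :
    IsEdge ω' e := by
  obtain ⟨hc, hω⟩ := he
  exact ⟨hc, by rw [← h _ (heS hc), hω]⟩

lemma determinedBy_explore_eq (i : ℕ) :
    DeterminedBy {ω | explore ω v i = A} {e : EdgeIdx n | ¬ Disjoint e.1 A} := by
  intro ω ω' h hω
  refine explore_eq_of_edges hω (fun e he hd => ?_) (fun e he hs => ?_)
  · exact isEdge_congr (fun i hi => (h i hi).symm) he fun _ => hd
  · refine isEdge_congr h he fun _ hd => ?_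
    have := two_le_card_of_isEdge he
    have he0 : e = ∅ :=
      Finset.subset_empty.1 fun x hx => absurd (hs hx) (Finset.disjoint_left.1 hd hx)
    simp [he0] at this

lemma determinedBy_deleteMeeting (Q : (EdgeIdx n → Bool) → Prop) :
    DeterminedBy {ω | Q (deleteMeeting A ω)} {e : EdgeIdx n | Disjoint e.1 A} := by
  intro ω ω' h hω
  have : deleteMeeting A ω' = deleteMeeting A ω := by
    ext e
    by_cases hd : Disjoint e.1 A
    · simp [deleteMeeting, h e hd]
    · simp [deleteMeeting, hd]
  simpa [this] using hω

/-- The potential edges consisting of one vertex of `A` and otherwise vertices of `B`. -/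
def crossing (A B : Finset (Fin n)) : Finset (EdgeIdx n) :=
  {e | ∃ a ∈ A, a ∈ e.1 ∧ e.1.erase a ⊆ B}

lemma sum_edgeProb_crossing_le (h₂ : 0 ≤ p₂) (h₃ : 0 ≤ p₃) :
    ∑ e ∈ crossing A B, edgeProb n p₂ p₃ e ≤
      A.card * B.card * p₂ + A.card * B.card ^ 2 * p₃ := by
  unfold edgeProb
  rw [Finset.sum_ite, Finset.sum_const, Finset.sum_const, nsmul_eq_mul, nsmul_eq_mul]
  gcongr
  · have hsub : ((crossing A B).filter fun e => e.1.card = 2).map (Function.Embedding.subtype _) ⊆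
        (A ×ˢ B).image fun x => {x.1, x.2} := by
      intro e he
      simp only [crossing, Finset.mem_map, Finset.mem_filter, Finset.mem_univ, true_and,
        Function.Embedding.subtype_apply] at he
      obtain ⟨e, ⟨⟨a, haA, hae, hs⟩, hc⟩, rfl⟩ := he
      have hc1 : (e.1.erase a).card = 1 := by rw [Finset.card_erase_of_mem hae, hc]
      obtain ⟨b, hb⟩ := Finset.card_eq_one.1 hc1
      refine Finset.mem_image.2 ⟨(a, b), Finset.mem_product.2 ⟨haA, hs (by simp [hb])⟩, ?_⟩
      rw [← Finset.insert_erase hae, hb]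
    have h := (Finset.card_le_card hsub).trans Finset.card_image_le
    rw [Finset.card_map, Finset.card_product] at h
    exact_mod_cast h
  · have hsub : ((crossing A B).filter fun e => ¬ e.1.card = 2).map (Function.Embedding.subtype _) ⊆
        (A ×ˢ B ×ˢ B).image fun x => {x.1, x.2.1, x.2.2} := by
      intro e he
      simp only [crossing, Finset.mem_map, Finset.mem_filter, Finset.mem_univ, true_and,
        Function.Embedding.subtype_apply] at he
      obtain ⟨e, ⟨⟨a, haA, hae, hs⟩, hc⟩, rfl⟩ := he
      have hc1 : (e.1.erase a).card = 2 := by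
        rw [Finset.card_erase_of_mem hae]
        have := e.2
        omega
      obtain ⟨b, c, -, hb⟩ := Finset.card_eq_two.1 hc1
      refine Finset.mem_image.2 ⟨(a, b, c), Finset.mem_product.2 ⟨haA,
        Finset.mem_product.2 ⟨hs (by simp [hb]), hs (by simp [hb])⟩⟩, ?_⟩
      rw [← Finset.insert_erase hae, hb]
    have h := (Finset.card_le_card hsub).trans Finset.card_image_le
    rw [Finset.card_map, Finset.card_product, Finset.card_product, ← sq] at h
    exact_mod_cast h

lemma explore_eq_update {ω : EdgeIdx n → Bool} {i : ℕ} (hAB : Disjoint A B)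
    (h : explore ω v i = A) {e : EdgeIdx n} (he : e ∈ crossing A B) :
    explore (Function.update ω e false) v i = A := by
  refine explore_eq_of_edges h (fun f hf _ => ?_) (fun f hf hs => ?_)
  · obtain ⟨hc, hω⟩ := hf
    refine ⟨hc, ?_⟩
    by_cases hfe : (⟨f, hc⟩ : EdgeIdx n) = e
    · simp [hfe] at hω
    · rwa [Function.update_of_ne hfe] at hω
  · obtain ⟨hc, hω⟩ := hf
    refine ⟨hc, ?_⟩
    have hfe : (⟨f, hc⟩ : EdgeIdx n) ≠ e := by
      rintro rfl
      simp only [crossing, Finset.mem_filter, Finset.mem_univ, true_and] at he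
      obtain ⟨a, -, haf, hB⟩ := he
      have hpos : 0 < (f.erase a).card := by
        rw [Finset.card_erase_of_mem haf]
        omega
      obtain ⟨y, hy⟩ := Finset.card_pos.1 hpos
      exact Finset.disjoint_left.1 hAB (hs (Finset.mem_of_mem_erase hy)) (hB hy)
    rwa [Function.update_of_ne hfe]

lemma deleteMeeting_update {ω : EdgeIdx n → Bool} {e : EdgeIdx n} (he : e ∈ crossing A B) :
    deleteMeeting A (Function.update ω e false) = deleteMeeting A ω := by
  ext f
  by_cases hfe : f = e
  · subst hfe
    simp only [crossing, Finset.mem_filter, Finset.mem_univ, true_and] at he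
    obtain ⟨a, haA, haf, -⟩ := he
    have : ¬ Disjoint f.1 A := Finset.not_disjoint_iff.2 ⟨a, haf, haA⟩
    simp [deleteMeeting, this]
  · simp [deleteMeeting, hfe]

lemma real_explore_eq_inter_crossing_le (h₂ : p₂ ∈ Set.Icc (0 : ℝ) 1)
    (h₃ : p₃ ∈ Set.Icc (0 : ℝ) 1) (i : ℕ) (hAB : Disjoint A B) :
    (bernPi (edgeProb n p₂ p₃)).real (({ω | explore ω u i = A} ∩
        {ω | component (deleteMeeting A ω) v = B}) ∩ ⋃ e ∈ crossing A B, {ω | ω e = true}) ≤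
      (A.card * B.card * p₂ + A.card * B.card ^ 2 * p₃) *
        (bernPi (edgeProb n p₂ p₃)).real ({ω | explore ω u i = A} ∩
          {ω | component (deleteMeeting A ω) v = B}) := by
  have := isProbabilityMeasure_bernPi (edgeProb_mem_Icc (n := n) h₂ h₃)
  rw [Set.inter_iUnion₂]
  refine (measureReal_biUnion_finset_le _ _).trans ?_
  refine (Finset.sum_le_sum fun e he =>
    bernPi_real_inter_true_le (edgeProb_mem_Icc h₂ h₃) e ?_).trans ?_
  · rintro ω ⟨hω, hω'⟩
    refine ⟨explore_eq_update hAB hω he, ?_⟩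
    rwa [Set.mem_ofPred_eq, deleteMeeting_update he]
  · rw [← Finset.sum_mul]
    gcongr
    exact sum_edgeProb_crossing_le h₂.1 h₃.1

lemma real_explore_eq_inter_largeComponent_le (h₂ : p₂ ∈ Set.Icc (0 : ℝ) 1)
    (h₃ : p₃ ∈ Set.Icc (0 : ℝ) 1) (i : ℕ) (hA : A.card = k) (hv : v ∉ A) :
    (bernPi (edgeProb n p₂ p₃)).real ({ω | explore ω u i = A} ∩ largeComponent k v) ≤
      (bernPi (edgeProb n p₂ p₃)).real {ω | explore ω u i = A} *
        ((bernPi (edgeProb n p₂ p₃)).real (largeComponent k v) + (k ^ 2 * p₂ + k ^ 3 * p₃)) := by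
  classical
  have := isProbabilityMeasure_bernPi (edgeProb_mem_Icc (n := n) h₂ h₃)
  set μ := bernPi (edgeProb n p₂ p₃)
  set E : Set (EdgeIdx n → Bool) := {ω | explore ω u i = A}
  set L : Set (EdgeIdx n → Bool) := {ω | k ≤ (component (deleteMeeting A ω) v).card}
  set D : Finset (Fin n) → Set (EdgeIdx n → Bool) :=
    fun B => {ω | component (deleteMeeting A ω) v = B}
  set 𝓑 : Finset (Finset (Fin n)) := {B | Disjoint A B ∧ B.card < k}
  have hind : ∀ Q : (EdgeIdx n → Bool) → Prop, μ.real (E ∩ {ω | Q (deleteMeeting A ω)}) =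
      μ.real E * μ.real {ω | Q (deleteMeeting A ω)} := by
    intro Q
    refine bernPi_real_inter (edgeProb_mem_Icc h₂ h₃) (determinedBy_explore_eq i)
      (determinedBy_deleteMeeting Q) ?_
    exact Set.disjoint_left.2 fun e h h' => h h'
  have hcover : E ∩ largeComponent k v ⊆
      (E ∩ L) ∪ ⋃ B ∈ 𝓑, (E ∩ D B) ∩ ⋃ e ∈ crossing A B, {ω | ω e = true} := by
    rintro ω ⟨hE, hω⟩
    by_cases hL : ω ∈ L
    · exact Or.inl ⟨hE, hL⟩
    · right
      have hlt : (component (deleteMeeting A ω) v).card < k := not_le.1 hL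
      have hω' : k ≤ (component ω v).card := hω
      obtain ⟨a, haA, e, ⟨hc, he⟩, hae, hs⟩ := exists_edge_into hv (hlt.trans_le hω')
      simp only [Set.mem_iUnion]
      refine ⟨component (deleteMeeting A ω) v, ?_, ⟨hE, rfl⟩, ?_⟩
      · simpa [𝓑] using ⟨(disjoint_component_deleteMeeting hv).symm, hlt⟩
      · simp only [Set.mem_iUnion]
        exact ⟨⟨e, hc⟩, by simpa [crossing] using ⟨a, haA, hae, hs⟩, he⟩
  have hB : ∑ B ∈ 𝓑, μ.real (D B) ≤ 1 := by
    rw [← measureReal_biUnion_finset _ fun _ _ => .of_discrete]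
    · exact measureReal_le_one
    · intro B _ B' _ hBB'
      refine Set.disjoint_left.2 fun ω h h' => hBB' ?_
      exact Eq.trans (Eq.symm h) h'
  have hτ : 0 ≤ k ^ 2 * p₂ + k ^ 3 * p₃ := by
    have := h₂.1
    have := h₃.1
    positivity
  calc μ.real (E ∩ largeComponent k v)
      ≤ μ.real (E ∩ L) + ∑ B ∈ 𝓑, μ.real ((E ∩ D B) ∩ ⋃ e ∈ crossing A B, {ω | ω e = true}) :=
        (measureReal_mono hcover).trans ((measureReal_union_le _ _).trans
          (by gcongr; exact measureReal_biUnion_finset_le _ _))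
    _ ≤ μ.real E * μ.real (largeComponent k v) +
          ∑ B ∈ 𝓑, (k ^ 2 * p₂ + k ^ 3 * p₃) * (μ.real E * μ.real (D B)) := by
        gcongr with B hB
        · rw [hind fun ω => k ≤ (component ω v).card]
          refine mul_le_mul_of_nonneg_left (measureReal_mono fun ω hω => ?_) measureReal_nonneg
          exact le_trans hω (Finset.card_le_card component_deleteMeeting_subset)
        · rw [← hind fun ω => component ω v = B]
          simp only [𝓑, Finset.mem_filter, Finset.mem_univ, true_and] at hB
          refine (real_explore_eq_inter_crossing_le h₂ h₃ i hB.1).trans ?_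
          refine mul_le_mul_of_nonneg_right ?_ measureReal_nonneg
          have h2 := h₂.1
          have h3 := h₃.1
          have hk : (B.card : ℝ) ≤ k := by exact_mod_cast hB.2.le
          rw [hA]
          calc (k : ℝ) * B.card * p₂ + k * B.card ^ 2 * p₃
              ≤ (k : ℝ) * k * p₂ + k * k ^ 2 * p₃ := by gcongr
            _ = _ := by ring
    _ = μ.real E * μ.real (largeComponent k v) +
          (k ^ 2 * p₂ + k ^ 3 * p₃) * (μ.real E * ∑ B ∈ 𝓑, μ.real (D B)) := by
        rw [Finset.mul_sum, Finset.mul_sum]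
    _ ≤ μ.real E * μ.real (largeComponent k v) +
          (k ^ 2 * p₂ + k ^ 3 * p₃) * (μ.real E * 1) := by gcongr
    _ = _ := by ring

lemma largeComponent_eq_biUnion (hk : 1 ≤ k) : largeComponent k u =
    ⋃ A ∈ Finset.powersetCard k (Finset.univ : Finset (Fin n)),
      {ω | explore ω u (k - 1) = A} := by
  ext ω
  simp [largeComponent, le_card_component_iff hk]

/-- Given that `u` has a large component, the expected number of vertices with a large component
is at most its unconditional value plus a small error. -/
lemma sum_real_largeComponent_inter_le (h₂ : p₂ ∈ Set.Icc (0 : ℝ) 1)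
    (h₃ : p₃ ∈ Set.Icc (0 : ℝ) 1) (hk : 1 ≤ k) (u : Fin n) :
    ∑ v, (bernPi (edgeProb n p₂ p₃)).real (largeComponent k u ∩ largeComponent k v) ≤
      (bernPi (edgeProb n p₂ p₃)).real (largeComponent k u) *
        (k + ∑ v, (bernPi (edgeProb n p₂ p₃)).real (largeComponent k v) +
          n * (k ^ 2 * p₂ + k ^ 3 * p₃)) := by
  have := isProbabilityMeasure_bernPi (edgeProb_mem_Icc (n := n) h₂ h₃)
  set μ := bernPi (edgeProb n p₂ p₃)
  set E : Finset (Fin n) → Set (EdgeIdx n → Bool) := fun A => {ω | explore ω u (k - 1) = A}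
  have hdisj : ∀ R : Set (EdgeIdx n → Bool),
      (Finset.powersetCard k (Finset.univ : Finset (Fin n)) : Set (Finset (Fin n))).PairwiseDisjoint
        fun A => E A ∩ R := by
    intro R A _ A' _ hAA'
    exact Set.disjoint_left.2 fun ω h h' => hAA' (Eq.trans (Eq.symm h.1) h'.1)
  have hsum : ∀ R : Set (EdgeIdx n → Bool), μ.real (largeComponent k u ∩ R) =
      ∑ A ∈ Finset.powersetCard k (Finset.univ : Finset (Fin n)), μ.real (E A ∩ R) := by
    intro R
    rw [largeComponent_eq_biUnion hk, Set.iUnion₂_inter,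
      measureReal_biUnion_finset (hdisj R) fun _ _ => .of_discrete]
  have hsum' := hsum Set.univ
  simp only [Set.inter_univ] at hsum'
  have hτ : 0 ≤ k ^ 2 * p₂ + k ^ 3 * p₃ := by
    have := h₂.1
    have := h₃.1
    positivity
  simp_rw [hsum]
  rw [Finset.sum_comm, hsum', Finset.sum_mul]
  refine Finset.sum_le_sum fun A hA => ?_
  have hAk : A.card = k := (Finset.mem_powersetCard.1 hA).2
  rw [← Finset.sum_add_sum_compl A]
  calc _ ≤ ∑ v ∈ A, μ.real (E A) +
        ∑ v ∈ Aᶜ, μ.real (E A) * (μ.real (largeComponent k v) + (k ^ 2 * p₂ + k ^ 3 * p₃)) := by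
        refine add_le_add
          (Finset.sum_le_sum fun v _ => measureReal_mono Set.inter_subset_left)
          (Finset.sum_le_sum fun v hv => ?_)
        exact real_explore_eq_inter_largeComponent_le h₂ h₃ (k - 1) hAk (Finset.mem_compl.1 hv)
    _ ≤ ∑ v ∈ A, μ.real (E A) +
        ∑ v, μ.real (E A) * (μ.real (largeComponent k v) + (k ^ 2 * p₂ + k ^ 3 * p₃)) := by
        gcongr
        exact Finset.subset_univ _
    _ = _ := by
        rw [← Finset.mul_sum, Finset.sum_add_distrib, Finset.sum_const, Finset.sum_const, hAk,
          Finset.card_univ, Fintype.card_fin, nsmul_eq_mul, nsmul_eq_mul]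
        ring

end SecondMoment

/-! ### Lower bound on the probability of a large component -/

section Growth

variable {n : ℕ} {p₂ p₃ : ℝ} {m : ℕ} {P Q G G' : Finset (Fin n)} {v x : Fin n}

/-- Starting from the processed set `P` and the active set `G`, one can repeat `j` times: find `m`
new vertices by edges meeting the active set, which then become the active set. -/
def Grows (ω : EdgeIdx n → Bool) (m : ℕ) : ℕ → Finset (Fin n) → Finset (Fin n) → Prop
  | 0, _, _ => True
  | j + 1, P, G => ∃ G' : Finset (Fin n), G'.card = m ∧ Disjoint G' (P ∪ G) ∧
      (∀ x ∈ G', ∃ e, IsEdge ω e ∧ x ∈ e ∧ e.erase x ⊆ P ∪ G ∧ ¬ Disjoint (e.erase x) G) ∧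
      Grows ω m j (P ∪ G) G'

lemma Grows.le_card_component {ω : EdgeIdx n → Bool} {j : ℕ} (h : Grows ω m j P G)
    (hs : P ∪ G ⊆ component ω v) : (P ∪ G).card + j * m ≤ (component ω v).card := by
  induction j generalizing P G with
  | zero => simpa using Finset.card_le_card hs
  | succ j ih =>
    obtain ⟨G', hm, hd, hatt, hG⟩ := h
    have h' := ih hG (Finset.union_subset hs fun x hx => by
      obtain ⟨e, he, hxe, hes, -⟩ := hatt x hx
      exact mem_of_addable_eq_empty addable_component he hxe (hes.trans hs))
    rw [Finset.card_union_of_disjoint hd.symm, hm] at h'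
    linarith

lemma determinedBy_grows (j : ℕ) (P G : Finset (Fin n)) (hPG : Disjoint P G) :
    DeterminedBy {ω | Grows ω m j P G} {e : EdgeIdx n | 2 ≤ (e.1 \ P).card} := by
  induction j generalizing P G with
  | zero => exact fun _ _ _ _ => trivial
  | succ j ih =>
    rintro ω ω' hω ⟨G', hm, hd, hatt, hG⟩
    refine ⟨G', hm, hd, fun x hx => ?_, ih _ _ hd.symm (fun e he => hω e ?_) hG⟩
    · obtain ⟨e, he, hxe, hes, hdis⟩ := hatt x hx
      refine ⟨e, isEdge_congr hω he fun _ => ?_, hxe, hes, hdis⟩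
      obtain ⟨a, ha, haG⟩ := Finset.not_disjoint_iff.1 hdis
      have hxP : x ∉ P := fun h => Finset.disjoint_left.1 hd hx (Finset.mem_union_left _ h)
      refine Finset.one_lt_card.2 ⟨x, Finset.mem_sdiff.2 ⟨hxe, hxP⟩, a,
        Finset.mem_sdiff.2 ⟨Finset.mem_of_mem_erase ha,
          fun h => Finset.disjoint_left.1 hPG h haG⟩, (Finset.ne_of_mem_erase ha).symm⟩
    · exact le_trans he (Finset.card_le_card
        (Finset.sdiff_subset_sdiff subset_rfl Finset.subset_union_left))

/-- The potential edges `{a, x}` and `{a, b, x}` with `a ∈ G` and `b ∈ Q`. -/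
def attachEdges (Q G : Finset (Fin n)) (x : Fin n) : Finset (EdgeIdx n) :=
  (G.image fun a => {a, x}).subtype _ ∪ ((G ×ˢ Q).image fun y => {y.1, y.2, x}).subtype _

lemma prod_attachEdges (hQG : Disjoint Q G) (hx : x ∉ Q ∪ G) :
    ∏ e ∈ attachEdges Q G x, (1 - edgeProb n p₂ p₃ e) =
      (1 - p₂) ^ G.card * (1 - p₃) ^ (G.card * Q.card) := by
  simp only [Finset.mem_union, not_or] at hx
  have hne : ∀ a ∈ G, a ≠ x := fun a ha h => hx.2 (h ▸ ha)
  have hne' : ∀ b ∈ Q, b ≠ x := fun b hb h => hx.1 (h ▸ hb)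
  have hab : ∀ a ∈ G, ∀ b ∈ Q, a ≠ b := fun a ha b hb h =>
    Finset.disjoint_left.1 hQG hb (h ▸ ha)
  have hc2 : ∀ a ∈ G, ({a, x} : Finset (Fin n)).card = 2 := fun a ha =>
    Finset.card_pair (hne a ha)
  have hc3 : ∀ y ∈ G ×ˢ Q, ({y.1, y.2, x} : Finset (Fin n)).card = 3 := fun y hy => by
    rw [Finset.mem_product] at hy
    exact Finset.card_eq_three.2 ⟨_, _, _, hab _ hy.1 _ hy.2, hne _ hy.1, hne' _ hy.2, rfl⟩
  have hdis : Disjoint ((G.image fun a => {a, x}).subtype fun e : Finset (Fin n) =>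
      e.card = 2 ∨ e.card = 3) (((G ×ˢ Q).image fun y => {y.1, y.2, x}).subtype _) := by
    rw [Finset.disjoint_left]
    intro e he he'
    obtain ⟨a, ha, hae⟩ := Finset.mem_image.1 (Finset.mem_subtype.1 he)
    obtain ⟨y, hy, hye⟩ := Finset.mem_image.1 (Finset.mem_subtype.1 he')
    have h2 := hc2 a ha
    have h3 := hc3 y hy
    rw [hae] at h2
    rw [hye] at h3
    omega
  have hprod : ∀ s : Finset (Finset (Fin n)), (∀ e ∈ s, e.card = 2 ∨ e.card = 3) →
      ∏ e ∈ s.subtype fun e => e.card = 2 ∨ e.card = 3, (1 - edgeProb n p₂ p₃ e) =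
        ∏ e ∈ s, (1 - if e.card = 2 then p₂ else p₃) := fun s hs =>
    Finset.prod_subtype_of_mem (fun e : Finset (Fin n) => 1 - if e.card = 2 then p₂ else p₃) hs
  rw [attachEdges, Finset.prod_union hdis, hprod, hprod, Finset.prod_image, Finset.prod_image,
    Finset.prod_congr rfl fun a ha => by rw [if_pos (hc2 a ha)],
    Finset.prod_congr (rfl : G ×ˢ Q = G ×ˢ Q) fun y hy => by
      rw [if_neg (by rw [hc3 y hy]; norm_num)]]
  · simp
  · rintro ⟨a, b⟩ hy ⟨a', b'⟩ hy' h
    simp only [Finset.coe_product, Set.mem_prod, Finset.mem_coe] at hy hy'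
    have h1 : a ∈ ({a', b', x} : Finset (Fin n)) := by
      rw [← show _ = ({a', b', x} : Finset (Fin n)) from h]; simp
    have h2 : b ∈ ({a', b', x} : Finset (Fin n)) := by
      rw [← show _ = ({a', b', x} : Finset (Fin n)) from h]; simp
    simp only [Finset.mem_insert, Finset.mem_singleton, hne a hy.1, hab a hy.1 b' hy'.2,
      or_false] at h1
    simp only [Finset.mem_insert, Finset.mem_singleton, hne' b hy.2, (hab a' hy'.1 b hy.2).symm,
      or_false, false_or] at h2
    rw [h1, h2]
  · intro a ha a' ha' h
    have h1 : a ∈ ({a', x} : Finset (Fin n)) := by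
      rw [← show _ = ({a', x} : Finset (Fin n)) from h]; simp
    simpa [hne a ha] using h1
  · intro e he
    obtain ⟨y, hy, rfl⟩ := Finset.mem_image.1 he
    exact Or.inr (hc3 y hy)
  · intro e he
    obtain ⟨a, ha, rfl⟩ := Finset.mem_image.1 he
    exact Or.inl (hc2 a ha)

lemma mem_attachEdges {e : EdgeIdx n} (he : e ∈ attachEdges Q G x) (hx : x ∉ G) :
    x ∈ e.1 ∧ e.1.erase x ⊆ Q ∪ G ∧ ¬ Disjoint (e.1.erase x) G := by
  simp only [attachEdges, Finset.mem_union, Finset.mem_subtype, Finset.mem_image,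
    Finset.mem_product] at he
  rcases he with ⟨a, ha, he⟩ | ⟨⟨a, b⟩, ⟨ha, hb⟩, he⟩
  · have hax : a ≠ x := fun h => hx (h ▸ ha)
    rw [← he]
    refine ⟨by simp, fun y hy => ?_, Finset.not_disjoint_iff.2 ⟨a, by simp [hax], ha⟩⟩
    simp only [Finset.mem_erase, Finset.mem_insert, Finset.mem_singleton] at hy
    rcases hy with ⟨hyx, rfl | rfl⟩
    · exact Finset.mem_union_right _ ha
    · exact absurd rfl hyx
  · simp only at ha hb he
    have hax : a ≠ x := fun h => hx (h ▸ ha)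
    rw [← he]
    refine ⟨by simp, fun y hy => ?_, Finset.not_disjoint_iff.2 ⟨a, by simp [hax], ha⟩⟩
    simp only [Finset.mem_erase, Finset.mem_insert, Finset.mem_singleton] at hy
    rcases hy with ⟨hyx, rfl | rfl | rfl⟩
    · exact Finset.mem_union_right _ ha
    · exact Finset.mem_union_left _ hb
    · exact absurd rfl hyx

/-- The event that exactly the vertices of `G'`, among those outside `P ∪ G`, are attached to `G`
by an edge `{a, x}` or `{a, b, x}` with `a ∈ G` and `b ∈ Q`. -/
def attachedExactly (P Q G G' : Finset (Fin n)) : Set (EdgeIdx n → Bool) :=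
  ⋂ x ∈ (P ∪ G)ᶜ, {ω | (∃ e ∈ attachEdges Q G x, ω e = true) ↔ x ∈ G'}

lemma determinedBy_attached (Q G : Finset (Fin n)) (x : Fin n) (q : Prop) :
    DeterminedBy {ω | (∃ e ∈ attachEdges Q G x, ω e = true) ↔ q} (attachEdges Q G x) := by
  intro ω ω' h hω
  rw [Set.mem_ofPred_eq] at hω ⊢
  rw [← hω]
  exact exists_congr fun e => and_congr_right fun he => by rw [h e he]

lemma real_attachedExactly (h₂ : p₂ ∈ Set.Icc (0 : ℝ) 1) (h₃ : p₃ ∈ Set.Icc (0 : ℝ) 1)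
    (hPG : Disjoint P G) (hQ : Q ⊆ P) (hG' : G' ⊆ (P ∪ G)ᶜ) :
    (bernPi (edgeProb n p₂ p₃)).real (attachedExactly P Q G G') =
      (1 - (1 - p₂) ^ G.card * (1 - p₃) ^ (G.card * Q.card)) ^ G'.card *
        ((1 - p₂) ^ G.card * (1 - p₃) ^ (G.card * Q.card)) ^ ((P ∪ G)ᶜ.card - G'.card) := by
  have := isProbabilityMeasure_bernPi (edgeProb_mem_Icc (n := n) h₂ h₃)
  have hp := edgeProb_mem_Icc (n := n) h₂ h₃
  have hnot : ∀ {x}, x ∈ (P ∪ G)ᶜ → x ∉ Q ∪ G := fun hx h =>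
    Finset.mem_compl.1 hx (Finset.union_subset_union_left hQ h)
  rw [attachedExactly, bernPi_real_biInter hp _ (fun x _ => determinedBy_attached Q G x _)]
  · have hval : ∀ x ∈ (P ∪ G)ᶜ, (bernPi (edgeProb n p₂ p₃)).real
        {ω | (∃ e ∈ attachEdges Q G x, ω e = true) ↔ x ∈ G'} =
        if x ∈ G' then 1 - (1 - p₂) ^ G.card * (1 - p₃) ^ (G.card * Q.card)
        else (1 - p₂) ^ G.card * (1 - p₃) ^ (G.card * Q.card) := by
      intro x hx
      have hprod := prod_attachEdges (p₂ := p₂) (p₃ := p₃)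
        (Finset.disjoint_of_subset_left hQ hPG) (hnot hx)
      split_ifs with h
      · simp only [h, iff_true]
        rw [bernPi_real_exists_true hp, hprod]
      · simp only [h, iff_false]
        rw [← hprod, ← bernPi_real_forall_false hp]
        congr 1
        ext ω
        simp
    rw [Finset.prod_congr rfl hval, Finset.prod_ite, Finset.prod_const, Finset.prod_const]
    have h1 : (P ∪ G)ᶜ.filter (· ∈ G') = G' := by
      rw [Finset.filter_mem_eq_inter, Finset.inter_eq_right.2 hG']
    have h2 : (P ∪ G)ᶜ.filter (· ∉ G') = (P ∪ G)ᶜ \ G' := Finset.filter_notMem_eq_sdiff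
    rw [h1, h2, Finset.card_sdiff_of_subset hG']
  · intro x hx y hy hxy
    refine Set.disjoint_left.2 fun e he he' => ?_
    have hx' := hnot hx
    have hy' := hnot hy
    have hxe := mem_attachEdges he fun h => hx' (Finset.mem_union_right _ h)
    have hye := mem_attachEdges he' fun h => hy' (Finset.mem_union_right _ h)
    exact hy' (hxe.2.1 (Finset.mem_erase.2 ⟨hxy.symm, hye.1⟩))

/-- The probability that exactly `m` of `N` vertices are attached, when each of them is attached
by `g` potential pairs and `g * c` potential triples. -/
noncomputable def stepProb (p₂ p₃ : ℝ) (N m g c : ℕ) : ℝ :=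
  N.choose m * ((1 - (1 - p₂) ^ g * (1 - p₃) ^ (g * c)) ^ m *
    ((1 - p₂) ^ g * (1 - p₃) ^ (g * c)) ^ (N - m))

lemma stepProb_nonneg (h₂ : p₂ ∈ Set.Icc (0 : ℝ) 1) (h₃ : p₃ ∈ Set.Icc (0 : ℝ) 1)
    (N m g c : ℕ) : 0 ≤ stepProb p₂ p₃ N m g c := by
  have h2 : 0 ≤ 1 - p₂ := by linarith [h₂.2]
  have h3 : 0 ≤ 1 - p₃ := by linarith [h₃.2]
  have h : (1 - p₂) ^ g * (1 - p₃) ^ (g * c) ≤ 1 :=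
    mul_le_one₀ (pow_le_one₀ h2 (by linarith [h₂.1])) (by positivity)
      (pow_le_one₀ h3 (by linarith [h₃.1]))
  have : 0 ≤ 1 - (1 - p₂) ^ g * (1 - p₃) ^ (g * c) := by linarith
  unfold stepProb
  positivity

lemma le_real_grows_succ (h₂ : p₂ ∈ Set.Icc (0 : ℝ) 1) (h₃ : p₃ ∈ Set.Icc (0 : ℝ) 1)
    (hPG : Disjoint P G) (hQ : Q ⊆ P) (j : ℕ) {b : ℝ}
    (hb : ∀ G', Disjoint (P ∪ G) G' → G'.card = m →
      b ≤ (bernPi (edgeProb n p₂ p₃)).real {ω | Grows ω m j (P ∪ G) G'}) :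
    stepProb p₂ p₃ (n - (P.card + G.card)) m G.card Q.card * b ≤
      (bernPi (edgeProb n p₂ p₃)).real {ω | Grows ω m (j + 1) P G} := by
  have := isProbabilityMeasure_bernPi (edgeProb_mem_Icc (n := n) h₂ h₃)
  have hp := edgeProb_mem_Icc (n := n) h₂ h₃
  set μ := bernPi (edgeProb n p₂ p₃)
  set E : Finset (Fin n) → Set (EdgeIdx n → Bool) :=
    fun G' => attachedExactly P Q G G' ∩ {ω | Grows ω m j (P ∪ G) G'}
  have hN : (P ∪ G)ᶜ.card = n - (P.card + G.card) := by
    rw [Finset.card_compl, Fintype.card_fin, Finset.card_union_of_disjoint hPG]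
  have hdisj : (Finset.powersetCard m (P ∪ G)ᶜ : Set (Finset (Fin n))).PairwiseDisjoint E := by
    intro A hA B hB hAB
    refine Set.disjoint_left.2 fun ω h h' => hAB ?_
    have hA := (Finset.mem_powersetCard.1 hA).1
    have hB := (Finset.mem_powersetCard.1 hB).1
    have h1 := h.1
    have h2 := h'.1
    simp only [attachedExactly, Set.mem_iInter, Set.mem_ofPred_eq] at h1 h2
    ext x
    exact ⟨fun hx => (h2 x (hA hx)).1 ((h1 x (hA hx)).2 hx),
      fun hx => (h1 x (hB hx)).1 ((h2 x (hB hx)).2 hx)⟩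
  have hsub : ⋃ G' ∈ Finset.powersetCard m (P ∪ G)ᶜ, E G' ⊆ {ω | Grows ω m (j + 1) P G} := by
    intro ω hω
    simp only [Set.mem_iUnion] at hω
    obtain ⟨G', hG', h1, h2⟩ := hω
    rw [Finset.mem_powersetCard] at hG'
    refine ⟨G', hG'.2, Finset.disjoint_left.2 fun x hx => Finset.mem_compl.1 (hG'.1 hx),
      fun x hx => ?_, h2⟩
    simp only [attachedExactly, Set.mem_iInter, Set.mem_ofPred_eq] at h1
    obtain ⟨e, he, hω⟩ := (h1 x (hG'.1 hx)).2 hx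
    have hxn := Finset.mem_compl.1 (hG'.1 hx)
    obtain ⟨hxe, hs, hd⟩ := mem_attachEdges he fun h => hxn (Finset.mem_union_right _ h)
    exact ⟨e.1, ⟨e.2, hω⟩, hxe, hs.trans (Finset.union_subset_union_left hQ), hd⟩
  refine le_trans ?_ (measureReal_mono hsub)
  rw [measureReal_biUnion_finset hdisj fun _ _ => .of_discrete]
  have hterm : ∀ G' ∈ Finset.powersetCard m (P ∪ G)ᶜ,
      (1 - (1 - p₂) ^ G.card * (1 - p₃) ^ (G.card * Q.card)) ^ m *
        ((1 - p₂) ^ G.card * (1 - p₃) ^ (G.card * Q.card)) ^ (n - (P.card + G.card) - m) * b ≤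
      μ.real (E G') := by
    intro G' hG'
    rw [Finset.mem_powersetCard] at hG'
    have hd : Disjoint (P ∪ G) G' :=
      Finset.disjoint_right.2 fun x hx => Finset.mem_compl.1 (hG'.1 hx)
    have hreal := real_attachedExactly h₂ h₃ hPG hQ hG'.1
    rw [hG'.2, hN] at hreal
    rw [bernPi_real_inter hp (S := {e | (e.1 \ (P ∪ G)).card < 2}) ?_
      (determinedBy_grows j (P ∪ G) G' hd), ← hreal]
    · exact mul_le_mul_of_nonneg_left (hb G' hd hG'.2) measureReal_nonneg
    · exact Set.disjoint_left.2 fun e he he' => not_lt.2 (show 2 ≤ _ from he') he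
    · refine determinedBy_biInter (fun x _ => determinedBy_attached Q G x _) fun x hx e he => ?_
      have hxn := Finset.mem_compl.1 hx
      obtain ⟨-, hs, -⟩ := mem_attachEdges he fun h => hxn (Finset.mem_union_right _ h)
      have : e.1 \ (P ∪ G) ⊆ {x} := by
        intro y hy
        rw [Finset.mem_sdiff] at hy
        by_contra hyx
        exact hy.2 (Finset.union_subset_union_left hQ
          (hs (Finset.mem_erase.2 ⟨by simpa using hyx, hy.1⟩)))
      exact Nat.lt_succ_of_le (by simpa using Finset.card_le_card this)
  refine le_trans (le_of_eq ?_) (Finset.sum_le_sum hterm)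
  rw [Finset.sum_const, Finset.card_powersetCard, hN, nsmul_eq_mul, stepProb]
  ring

lemma prod_stepProb_le_real_grows (h₂ : p₂ ∈ Set.Icc (0 : ℝ) 1) (h₃ : p₃ ∈ Set.Icc (0 : ℝ) 1)
    {c : ℕ → ℕ} (hc : ∀ i, c i ≤ 1 + i * m) (j : ℕ) :
    ∀ (i : ℕ) (P G : Finset (Fin n)), Disjoint P G → P.card = 1 + i * m → G.card = m →
      ∏ l ∈ Finset.range j, stepProb p₂ p₃ (n - (1 + (i + l + 1) * m)) m m (c (i + l)) ≤
        (bernPi (edgeProb n p₂ p₃)).real {ω | Grows ω m j P G} := by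
  have := isProbabilityMeasure_bernPi (edgeProb_mem_Icc (n := n) h₂ h₃)
  induction j with
  | zero =>
    intro i P G _ _ _
    simp [Grows]
  | succ j ih =>
    intro i P G hPG hP hG
    obtain ⟨Q, hQ, hQc⟩ := Finset.exists_subset_card_eq (hP ▸ hc i : c i ≤ P.card)
    refine le_trans (le_of_eq ?_) (le_real_grows_succ h₂ h₃ hPG hQ j
      (b := ∏ l ∈ Finset.range j,
        stepProb p₂ p₃ (n - (1 + (i + 1 + l + 1) * m)) m m (c (i + 1 + l))) fun G' hd hG' => ?_)
    · rw [Finset.prod_range_succ', mul_comm, hP, hG, hQc]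
      congr 1
      · congr 1
        simp only [add_zero]
        ring_nf
      · refine Finset.prod_congr rfl fun l _ => ?_
        rw [show i + (l + 1) = i + 1 + l by ring]
    · refine ih (i + 1) _ _ hd ?_ hG'
      rw [Finset.card_union_of_disjoint hPG, hP, hG]
      ring

lemma le_real_largeComponent (h₂ : p₂ ∈ Set.Icc (0 : ℝ) 1) (h₃ : p₃ ∈ Set.Icc (0 : ℝ) 1)
    {c : ℕ → ℕ} (hc : ∀ i, c i ≤ 1 + i * m) {j k : ℕ} (hk : k ≤ 1 + (j + 1) * m) (v : Fin n) :
    stepProb p₂ p₃ (n - 1) m 1 0 *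
        ∏ l ∈ Finset.range j, stepProb p₂ p₃ (n - (1 + (l + 1) * m)) m m (c l) ≤
      (bernPi (edgeProb n p₂ p₃)).real (largeComponent k v) := by
  have := isProbabilityMeasure_bernPi (edgeProb_mem_Icc (n := n) h₂ h₃)
  have h := le_real_grows_succ (P := ∅) (Q := ∅) (G := {v}) h₂ h₃ (by simp) subset_rfl j
    (b := ∏ l ∈ Finset.range j, stepProb p₂ p₃ (n - (1 + (l + 1) * m)) m m (c l))
    fun G' hd hG' => by
      simpa using prod_stepProb_le_real_grows h₂ h₃ hc j 0 _ G' hd (by simp) hG'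
  simp only [Finset.card_empty, Finset.card_singleton, zero_add] at h
  refine h.trans (measureReal_mono fun ω hω => ?_)
  have hcard := Grows.le_card_component (v := v) hω (by simpa using self_mem_component)
  rw [Finset.empty_union, Finset.card_singleton] at hcard
  exact hk.trans hcard

end Growth

/-! ### Estimates for a single generation -/

section Estimates

variable {ε r : ℝ}

lemma exp_neg_mul_div_le {n p : ℝ} (hn : 1 < n) (hp0 : 0 ≤ p) (hp : p ≤ 1 / n) :
    Real.exp (-(p * (n / (n - 1)))) ≤ 1 - p := by
  have hn0 : 0 < n := by linarith
  have h1n : 1 / n < 1 := by rw [div_lt_one hn0]; exact hn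
  have hpos : 0 < 1 - p := by linarith
  rw [← Real.le_log_iff_exp_le hpos]
  refine le_trans ?_ (Real.one_sub_inv_le_log_of_pos hpos)
  have h1 : 1 - (1 - p)⁻¹ = -(p * (1 / (1 - p))) := by field_simp; ring
  rw [h1]
  have h2 : 1 / (1 - p) ≤ n / (n - 1) := by
    rw [div_le_div_iff₀ hpos (by linarith)]
    have : p * n ≤ 1 := by rwa [le_div_iff₀ hn0] at hp
    linarith
  have := mul_le_mul_of_nonneg_left h2 hp0
  linarith

lemma mul_one_sub_le_one_sub_exp_neg {s : ℝ} (hs : 0 ≤ s) : s * (1 - s) ≤ 1 - Real.exp (-s) := by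
  have h : Real.exp (-s) ≤ (1 + s)⁻¹ := by
    rw [Real.exp_neg]
    gcongr
    linarith [Real.add_one_le_exp s]
  have h2 : (1 + s)⁻¹ ≤ 1 - s + s ^ 2 := by
    rw [inv_le_iff_one_le_mul₀ (by linarith)]
    nlinarith [pow_nonneg hs 3]
  linarith

lemma le_stepProb_of_le {n L : ℝ} {N M g c : ℕ} (hε1 : ε < 1) (hr : 0 < r)
    (hn : 1 < n) (hM : (M : ℝ) ≤ n) (hL : 0 < L) (hrL : r ≤ L) (hε0 : 0 < ε)
    (hg : g ≤ M) (hNn : (N : ℝ) ≤ n) (hMN : M ≤ N) (hc : 1 - ε + c * r / L ≤ 1) :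
    (g * (1 - ε + c * r / L)) ^ M * Real.exp (-(g * (1 - ε + c * r / L))) / M.factorial *
        (((N + 1 - M) / n * (1 - M / n)) ^ M * Real.exp (-(M / (n - 1)))) ≤
      stepProb ((1 - ε) / n) (r / (n * L)) N M g c := by
  set lam := 1 - ε + c * r / L with hlam
  have hn0 : 0 < n := by linarith
  have hlam0 : 0 < lam := by
    have : 0 ≤ c * r / L := by positivity
    linarith
  set p₂ := (1 - ε) / n with hp₂
  set p₃ := r / (n * L) with hp₃
  have h20 : 0 ≤ p₂ := div_nonneg (by linarith) hn0.le
  have h30 : 0 ≤ p₃ := by positivity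
  have h21 : p₂ ≤ 1 / n := by rw [hp₂]; gcongr; linarith
  have h31 : p₃ ≤ 1 / n := by
    rw [hp₃, div_le_div_iff₀ (by positivity) hn0]
    nlinarith
  have h1n : 1 / n < 1 := by rw [div_lt_one hn0]; exact hn
  set s := g * lam / n with hs
  have hs0 : 0 ≤ s := by positivity
  have hgM : (g : ℝ) ≤ M := by exact_mod_cast hg
  have hglam : g * lam ≤ M := by nlinarith [Nat.cast_nonneg (α := ℝ) g]
  have hsM : s ≤ M / n := by rw [hs]; gcongr
  have hseq : g * p₂ + (g * c : ℕ) * p₃ = s := by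
    rw [hs, hp₂, hp₃, hlam]
    push_cast
    field_simp
  set y := (1 - p₂) ^ g * (1 - p₃) ^ (g * c) with hy
  have hy0 : 0 ≤ y := mul_nonneg (pow_nonneg (by linarith) _) (pow_nonneg (by linarith) _)
  have hyle : y ≤ Real.exp (-s) := by
    rw [hy, ← hseq, neg_add, Real.exp_add, ← mul_neg, ← mul_neg, Real.exp_nat_mul, Real.exp_nat_mul]
    have a1 : 1 - p₂ ≤ Real.exp (-p₂) := Real.one_sub_le_exp_neg _
    have a2 : 1 - p₃ ≤ Real.exp (-p₃) := Real.one_sub_le_exp_neg _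
    have b1 : 0 ≤ 1 - p₂ := by linarith
    have b2 : 0 ≤ 1 - p₃ := by linarith
    gcongr
  have hley : Real.exp (-(s * (n / (n - 1)))) ≤ y := by
    have a1 := exp_neg_mul_div_le hn h20 h21
    have a2 := exp_neg_mul_div_le hn h30 h31
    have a3 : -((g * p₂ + (g * c : ℕ) * p₃) * (n / (n - 1))) =
        g * -(p₂ * (n / (n - 1))) + (g * c : ℕ) * -(p₃ * (n / (n - 1))) := by ring
    have b1 : 0 ≤ 1 - p₂ := by linarith
    rw [hy, ← hseq, a3, Real.exp_add, Real.exp_nat_mul, Real.exp_nat_mul]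
    gcongr
  have hy1 : y ≤ 1 := hyle.trans (by simpa using hs0)
  have hA : s * (1 - M / n) ≤ 1 - y := by
    have := mul_one_sub_le_one_sub_exp_neg hs0
    nlinarith
  have hMn : 0 ≤ 1 - M / n := by
    have : (M : ℝ) / n ≤ 1 := by rw [div_le_one hn0]; exact hM
    linarith
  have hB : Real.exp (-(g * lam)) * Real.exp (-(M / (n - 1))) ≤ y ^ (N - M) := by
    have h1 : y ^ ⌊n⌋₊ ≤ y ^ (N - M) := pow_le_pow_of_le_one hy0 hy1
      ((Nat.sub_le _ _).trans (Nat.le_floor hNn))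
    have h2 : Real.exp (-(s * (n / (n - 1)))) ^ ⌊n⌋₊ ≤ y ^ ⌊n⌋₊ := by gcongr
    refine le_trans ?_ (h2.trans h1)
    rw [← Real.exp_nat_mul, ← Real.exp_add, Real.exp_le_exp]
    have hn1 : 0 < n - 1 := by linarith
    have h3 : (⌊n⌋₊ : ℝ) * (s * (n / (n - 1))) ≤ n * (s * (n / (n - 1))) := by
      gcongr
      exact Nat.floor_le hn0.le
    have h4 : n * (s * (n / (n - 1))) = g * lam + g * lam / (n - 1) := by
      rw [hs]; field_simp; ring
    have h5 : g * lam / (n - 1) ≤ M / (n - 1) := by gcongr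
    linarith
  have hC : ((N : ℝ) + 1 - M) ^ M / M.factorial ≤ N.choose M := by
    have := Nat.pow_le_choose (α := ℝ) M N
    rwa [Nat.cast_sub (by omega), Nat.cast_add, Nat.cast_one] at this
  have hNM : (0 : ℝ) ≤ N + 1 - M := by
    have : (M : ℝ) ≤ N := by exact_mod_cast hMN
    linarith
  calc _ = ((N : ℝ) + 1 - M) ^ M / M.factorial * ((s * (1 - M / n)) ^ M *
        (Real.exp (-(g * lam)) * Real.exp (-(M / (n - 1))))) := by
        rw [hs]
        simp only [mul_pow, div_pow]
        ring
    _ ≤ _ := by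
        rw [stepProb]
        gcongr

lemma tendsto_log_sq_div_nat :
    Tendsto (fun n : ℕ => (Real.log n) ^ 2 / (n : ℝ)) atTop (nhds 0) := by
  have h := (isLittleO_pow_log_id_atTop (n := 2)).tendsto_div_nhds_zero
  exact h.comp tendsto_natCast_atTop_atTop

lemma eventually_half_le (M : ℕ) :
    ∀ᶠ n : ℕ in atTop, 0 ≤ 1 - ((Real.log n) ^ 2 + M) / n ∧
      1 / 2 ≤ ((1 - ((Real.log n) ^ 2 + M) / n) * (1 - M / n)) ^ M *
        Real.exp (-(M / ((n : ℝ) - 1))) := by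
  have hM : Tendsto (fun n : ℕ => (M : ℝ) / n) atTop (nhds 0) :=
    tendsto_const_div_atTop_nhds_zero_nat _
  have h1 : Tendsto (fun n : ℕ => 1 - ((Real.log n) ^ 2 + M) / (n : ℝ)) atTop (nhds 1) := by
    simpa [add_div] using (tendsto_log_sq_div_nat.add hM).const_sub 1
  have h2 : Tendsto (fun n : ℕ => 1 - (M : ℝ) / n) atTop (nhds 1) := by
    simpa using hM.const_sub 1
  have h3 : Tendsto (fun n : ℕ => Real.exp (-((M : ℝ) / ((n : ℝ) - 1)))) atTop (nhds 1) := by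
    have : Tendsto (fun n : ℕ => (M : ℝ) / ((n : ℝ) - 1)) atTop (nhds 0) :=
      Tendsto.const_div_atTop
        (tendsto_atTop_add_const_right _ (-1) tendsto_natCast_atTop_atTop) _
    simpa using this.neg.rexp
  have h := ((h1.mul h2).pow M).mul h3
  simp only [mul_one, one_pow] at h
  filter_upwards [h.eventually (lt_mem_nhds (by norm_num : (1 / 2 : ℝ) < 1)),
    h1.eventually (lt_mem_nhds one_pos)] with n hn hn'
  exact ⟨hn'.le, hn.le⟩

lemma tendsto_log_nat : Tendsto (fun n : ℕ => Real.log n) atTop atTop :=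
  Real.tendsto_log_atTop.comp tendsto_natCast_atTop_atTop

/-- Up to a factor `2`, the probability of finding exactly `M` new vertices is at least its
Poisson limit. -/
lemma eventually_le_stepProb (hε0 : 0 < ε) (hε1 : ε < 1) (hr : 0 < r) (M : ℕ) :
    ∀ᶠ n : ℕ in atTop, ∀ N g c : ℕ, g ≤ M → N ≤ n → (n : ℝ) - (Real.log n) ^ 2 ≤ N →
      1 - ε + c * r / Real.log n ≤ 1 →
      1 / 2 * ((g * (1 - ε + c * r / Real.log n)) ^ M *
        Real.exp (-(g * (1 - ε + c * r / Real.log n))) / M.factorial) ≤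
      stepProb ((1 - ε) / n) (r / (n * Real.log n)) N M g c := by
  filter_upwards [eventually_half_le M, tendsto_log_nat.eventually_ge_atTop (max r 1),
    eventually_ge_atTop (M + 2)] with n ⟨hθ0, hθ⟩ hL hn N g c hg hNn hN hc
  have hL1 : 1 ≤ Real.log n := (le_max_right _ _).trans hL
  have hn' : (M : ℝ) + 2 ≤ n := by exact_mod_cast hn
  have hM0 : (0 : ℝ) ≤ M := Nat.cast_nonneg M
  have hn0 : (0 : ℝ) < n := by linarith
  have hfrac : 1 - ((Real.log n) ^ 2 + M) / n ≤ (N + 1 - M) / n := by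
    rw [le_div_iff₀ hn0, sub_mul, div_mul_cancel₀ _ hn0.ne']
    linarith
  have hMN : M ≤ N := by
    have h : (0 : ℝ) ≤ N + 1 - M - 1 := by
      have : (0 : ℝ) ≤ (1 - ((Real.log n) ^ 2 + M) / n) * n := by positivity
      rw [sub_mul, div_mul_cancel₀ _ hn0.ne'] at this
      linarith
    have : (M : ℝ) ≤ N := by linarith
    exact_mod_cast this
  refine le_trans ?_ (le_stepProb_of_le hε1 hr (by linarith) (by linarith) (by linarith)
    ((le_max_left _ _).trans hL) hε0 hg (by exact_mod_cast hNn) hMN hc)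
  have hlam : 0 ≤ 1 - ε + c * r / Real.log n := by
    have : 0 ≤ c * r / Real.log n := by positivity
    linarith
  rw [mul_comm (1 / 2)]
  refine mul_le_mul_of_nonneg_left (hθ.trans ?_) (by positivity)
  have hMn : 0 ≤ 1 - (M : ℝ) / n := by
    have : (M : ℝ) / n ≤ 1 := by rw [div_le_one hn0]; linarith
    linarith
  gcongr

lemma factorial_le (M : ℕ) (hM : 1 ≤ M) :
    (M.factorial : ℝ) ≤ Real.exp 1 * M * (M ^ M * Real.exp (-M)) := by
  induction M, hM using Nat.le_induction with
  | base => simp [← Real.exp_add]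
  | succ M hM ih =>
    have hM0 : (0 : ℝ) < M := by exact_mod_cast hM
    have hkey : Real.exp 1 * (M : ℝ) ^ (M + 1) ≤ ((M : ℝ) + 1) ^ (M + 1) := by
      have h1 : 1 / ((M : ℝ) + 1) ≤ Real.log ((M + 1) / M) := by
        refine le_trans (le_of_eq ?_) (Real.one_sub_inv_le_log_of_pos (by positivity))
        field_simp
        ring
      have h2 : Real.exp (1 / ((M : ℝ) + 1)) ≤ (M + 1) / M := by
        rwa [← Real.le_log_iff_exp_le (by positivity)]
      have h3 : Real.exp (1 / ((M : ℝ) + 1)) ^ (M + 1) ≤ (((M : ℝ) + 1) / M) ^ (M + 1) := by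
        gcongr
      rw [← Real.exp_nat_mul, div_pow, le_div_iff₀ (by positivity)] at h3
      refine le_trans (le_of_eq ?_) h3
      congr 2
      push_cast
      field_simp
    calc ((M + 1).factorial : ℝ) = (M + 1) * M.factorial := by
          rw [Nat.factorial_succ]; push_cast; ring
      _ ≤ (M + 1) * (Real.exp 1 * M * (M ^ M * Real.exp (-M))) := by gcongr
      _ = (M + 1) * Real.exp (-M) * (Real.exp 1 * (M : ℝ) ^ (M + 1)) := by ring
      _ ≤ (M + 1) * Real.exp (-M) * ((M : ℝ) + 1) ^ (M + 1) := by gcongr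
      _ = _ := by
        push_cast
        rw [neg_add, Real.exp_add]
        have : Real.exp 1 * Real.exp (-1) = 1 := by rw [← Real.exp_add]; simp
        linear_combination (-(M + 1) * Real.exp (-M) * ((M : ℝ) + 1) ^ (M + 1)) * this

lemma exp_neg_le_poisson {M : ℕ} (hM : 1 ≤ M) {lam : ℝ} (hlam : 0 < lam) :
    1 / (Real.exp 1 * M) * Real.exp (-(M * (lam - 1 - Real.log lam))) ≤
      (M * lam) ^ M * Real.exp (-(M * lam)) / M.factorial := by
  have hM0 : (0 : ℝ) < M := by exact_mod_cast hM
  have hf : (0 : ℝ) < M.factorial := by exact_mod_cast M.factorial_pos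
  have h1 : Real.exp (-(M * (lam - 1 - Real.log lam))) =
      lam ^ M * Real.exp (-(M * lam)) * Real.exp M := by
    rw [← Real.exp_log (pow_pos hlam M), Real.log_pow, ← Real.exp_add, ← Real.exp_add]
    ring_nf
  rw [h1, div_mul_eq_mul_div, one_mul, div_le_div_iff₀ (by positivity) hf]
  calc _ ≤ lam ^ M * Real.exp (-(M * lam)) * Real.exp M *
        (Real.exp 1 * M * (M ^ M * Real.exp (-M))) := by
        gcongr
        exact factorial_le M hM
    _ = _ := by
        have : Real.exp M * Real.exp (-M) = 1 := by rw [← Real.exp_add]; simp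
        rw [mul_pow]
        linear_combination (lam ^ M * Real.exp (-(M * lam)) * (Real.exp 1 * M * M ^ M)) * this

end Estimates

/-! ### The large deviation rate -/

section Rate

/-- The primitive `x ↦ x²/2 - x log x` of the Poisson rate `x ↦ x - 1 - log x`. -/
noncomputable def ratePrim (x : ℝ) : ℝ := x ^ 2 / 2 - x * Real.log x

lemma mul_rate_le_ratePrim_sub {x y : ℝ} (hx : 0 < x) (hxy : x ≤ y) (hy : y ≤ 1) :
    (y - x) * (y - 1 - Real.log y) ≤ ratePrim y - ratePrim x := by
  rcases hxy.eq_or_lt with rfl | hlt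
  · simp
  have hd : ∀ z ∈ Set.Icc x y, HasDerivAt ratePrim (z - 1 - Real.log z) z := by
    intro z hz
    have hz0 : z ≠ 0 := (hx.trans_le hz.1).ne'
    have h := ((hasDerivAt_pow 2 z).div_const 2).sub (Real.hasDerivAt_mul_log hz0)
    refine (h.congr_deriv ?_)
    simp
    ring
  obtain ⟨c, hc, hceq⟩ := exists_hasDerivAt_eq_slope ratePrim (fun z => z - 1 - Real.log z) hlt
    (fun z hz => (hd z hz).continuousAt.continuousWithinAt)
    (fun z hz => hd z ⟨hz.1.le, hz.2.le⟩)
  have hc0 : 0 < c := hx.trans hc.1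
  have hy0 : 0 < y := hx.trans hlt
  rw [_root_.eq_div_iff (by linarith)] at hceq
  rw [← hceq, mul_comm]
  refine mul_le_mul_of_nonneg_right ?_ (by linarith)
  have h1 : 1 - (y / c)⁻¹ ≤ Real.log (y / c) := Real.one_sub_inv_le_log_of_pos (by positivity)
  rw [Real.log_div hy0.ne' hc0.ne', inv_div] at h1
  have h2 : y - c ≤ 1 - c / y := by
    have : 1 - c / y = (y - c) / y := by field_simp
    rw [this, le_div_iff₀ hy0]
    nlinarith [hc.2]
  linarith

lemma rate_le {x : ℝ} (hx : 0 < x) : x - 1 - Real.log x ≤ (1 - x) ^ 2 / x := by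
  have h := Real.one_sub_inv_le_log_of_pos hx
  have : (1 - x) ^ 2 / x = x - 1 - (1 - x⁻¹) := by field_simp; ring
  linarith

lemma sum_rate_le {ε a : ℝ} (hε0 : 0 < ε) (hε1 : ε < 1) (ha : 0 < a) (j : ℕ) :
    ∑ i ∈ Finset.range j, (1 - ε + a * (min (i + 1) ⌊ε / a⌋₊ : ℕ) - 1 -
      Real.log (1 - ε + a * (min (i + 1) ⌊ε / a⌋₊ : ℕ))) ≤
      (ε - ε ^ 2 / 2 + (1 - ε) * Real.log (1 - ε)) / a + j * (a ^ 2 / (1 - ε)) := by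
  set J := ⌊ε / a⌋₊ with hJ
  set lam : ℕ → ℝ := fun i => 1 - ε + a * (min i J : ℕ) with hlam
  have hJle : a * J ≤ ε := by
    have := Nat.floor_le (div_nonneg hε0.le ha.le)
    rwa [le_div_iff₀ ha, mul_comm] at this
  have hJlt : ε < a * (J + 1) := by
    have := Nat.lt_floor_add_one (ε / a)
    rwa [div_lt_iff₀ ha, mul_comm] at this
  have hle1 : ∀ i, lam i ≤ 1 := by
    intro i
    have : a * (min i J : ℕ) ≤ a * J := by gcongr; exact min_le_right _ _
    simp only [hlam]; linarith
  have hge : ∀ i, 1 - ε ≤ lam i := by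
    intro i
    have : 0 ≤ a * (min i J : ℕ) := by positivity
    simp only [hlam]; linarith
  have hstep : ∀ i, lam (i + 1) - 1 - Real.log (lam (i + 1)) ≤
      (ratePrim (lam (i + 1)) - ratePrim (lam i)) / a + a ^ 2 / (1 - ε) := by
    intro i
    have hnn : 0 ≤ a ^ 2 / (1 - ε) := div_nonneg (sq_nonneg _) (by linarith)
    rcases lt_or_ge i J with hi | hi
    · have heq : lam (i + 1) = lam i + a := by
        simp only [hlam, min_eq_left hi.le, min_eq_left (Nat.succ_le_of_lt hi)]
        push_cast
        ring
      have h := mul_rate_le_ratePrim_sub (x := lam i) (y := lam (i + 1))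
        (by linarith [hge i]) (by linarith) (hle1 _)
      rw [show lam (i + 1) - lam i = a by linarith] at h
      have : lam (i + 1) - 1 - Real.log (lam (i + 1)) ≤
          (ratePrim (lam (i + 1)) - ratePrim (lam i)) / a := by
        rwa [le_div_iff₀ ha, mul_comm]
      linarith
    · have heq : lam (i + 1) = lam i := by
        simp only [hlam, min_eq_right hi, min_eq_right (hi.trans (Nat.le_succ _))]
      rw [heq, sub_self, zero_div, zero_add]
      have h1 : 1 - lam i ≤ a := by
        simp only [hlam, min_eq_right hi]; linarith
      have hpos : 0 < lam i := by linarith [hge i]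
      refine (rate_le hpos).trans ?_
      have := hle1 i
      have := hge i
      have h0 : 0 ≤ 1 - lam i := by linarith
      have h2 : 0 < 1 - ε := by linarith
      gcongr
  refine (Finset.sum_le_sum fun i _ => hstep i).trans ?_
  rw [Finset.sum_add_distrib, ← Finset.sum_div, Finset.sum_range_sub (fun i => ratePrim (lam i)),
    Finset.sum_const, Finset.card_range, nsmul_eq_mul]
  gcongr
  have h := mul_rate_le_ratePrim_sub (x := lam j) (y := 1) (by linarith [hge j]) (hle1 j) le_rfl
  have h0 : lam 0 = 1 - ε := by simp [hlam]
  have h1 : ratePrim (1 - ε) = (1 - ε) ^ 2 / 2 - (1 - ε) * Real.log (1 - ε) := rfl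
  have h2 : ratePrim 1 = 1 / 2 := by simp [ratePrim]
  simp only [sub_self, Real.log_one, mul_zero] at h
  rw [h0, h1]
  nlinarith

lemma rate_nonneg {x : ℝ} (hx : 0 < x) : 0 ≤ x - 1 - Real.log x := by
  linarith [Real.log_le_sub_one_of_pos hx]

end Rate

/-! ### The lower bound for the probability of being good -/

section LowerBound

variable {ε r : ℝ}

lemma one_le_K0 : 1 ≤ K0 ε r := le_max_left _ _

lemma exists_mul_log_le {K b : ℝ} (hK : 0 < K) (hb : 0 < b) :
    ∃ M : ℕ, 1 ≤ M ∧ K * Real.log (2 * (Real.exp 1 * M)) ≤ b * M := by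
  have ht : Tendsto (fun M : ℕ => 2 * (Real.exp 1 * (M : ℝ))) atTop atTop :=
    (tendsto_natCast_atTop_atTop.const_mul_atTop (Real.exp_pos 1)).const_mul_atTop two_pos
  have h := ht.eventually (Real.isLittleO_log_id_atTop.bound
    (show 0 < b / (K * (2 * Real.exp 1)) by positivity))
  obtain ⟨M, hM, hM1⟩ := (h.and (eventually_ge_atTop 1)).exists
  refine ⟨M, hM1, ?_⟩
  have h1 := (le_abs_self _).trans hM
  rw [id, Real.norm_of_nonneg (by positivity)] at h1
  calc _ ≤ K * (b / (K * (2 * Real.exp 1)) * (2 * (Real.exp 1 * M))) := by gcongr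
    _ = _ := by field_simp

/-- The exponent produced by multiplying the Poisson lower bounds over `J` generations. -/
lemma exponent_le (hε0 : 0 < ε) (hε1 : ε < 1) (hr : 0 < r) {K b L : ℝ} {M J : ℕ} (hM : 1 ≤ M)
    (hL : 1 ≤ L) (hK : 0 < K) (hKb : K * Real.log (2 * (Real.exp 1 * M)) ≤ b * M)
    (hJ : (J : ℝ) ≤ K * L / M + 1) :
    J * Real.log (2 * (Real.exp 1 * M)) + M * ∑ l ∈ Finset.range J,
      (1 - ε + (M * min l ⌊ε / (r * M / L)⌋₊ : ℕ) * r / L - 1 -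
        Real.log (1 - ε + (M * min l ⌊ε / (r * M / L)⌋₊ : ℕ) * r / L)) ≤
    (b - Ier ε r) * L + (Real.log (2 * (Real.exp 1 * M)) + M * (-ε - Real.log (1 - ε)) +
      (K + M) * (r ^ 2 * M ^ 2) / (1 - ε)) := by
  have hM0 : (0 : ℝ) < M := by exact_mod_cast hM
  have hM1 : (1 : ℝ) ≤ M := by exact_mod_cast hM
  have hL0 : 0 < L := by linarith
  have hε : 0 < 1 - ε := by linarith
  set a := r * M / L with ha
  have ha0 : 0 < a := by positivity
  have hlog : 0 ≤ Real.log (2 * (Real.exp 1 * M)) := by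
    refine Real.log_nonneg ?_
    have := Real.add_one_le_exp (1 : ℝ)
    nlinarith
  have hlam : ∀ l : ℕ, 1 - ε + (M * min l ⌊ε / a⌋₊ : ℕ) * r / L =
      1 - ε + a * (min l ⌊ε / a⌋₊ : ℕ) := by
    intro l
    rw [ha]
    push_cast
    field_simp
  simp only [hlam]
  have h1 : ∑ l ∈ Finset.range J, (1 - ε + a * (min l ⌊ε / a⌋₊ : ℕ) - 1 -
        Real.log (1 - ε + a * (min l ⌊ε / a⌋₊ : ℕ))) ≤
      (ε - ε ^ 2 / 2 + (1 - ε) * Real.log (1 - ε)) / a + J * (a ^ 2 / (1 - ε)) +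
        (-ε - Real.log (1 - ε)) := by
    have hnn : ∀ l : ℕ, 0 ≤ 1 - ε + a * (min l ⌊ε / a⌋₊ : ℕ) - 1 -
        Real.log (1 - ε + a * (min l ⌊ε / a⌋₊ : ℕ)) := fun l => rate_nonneg (by positivity)
    refine (Finset.sum_le_sum_of_subset_of_nonneg
      (Finset.range_mono (Nat.le_succ J)) fun l _ _ => hnn l).trans ?_
    rw [Finset.sum_range_succ']
    refine add_le_add (sum_rate_le hε0 hε1 ha0 J) (le_of_eq ?_)
    simp
  have h2 : J * Real.log (2 * (Real.exp 1 * M)) ≤ b * L + Real.log (2 * (Real.exp 1 * M)) := by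
    have h3 : K * L / M * Real.log (2 * (Real.exp 1 * M)) ≤ b * L := by
      rw [div_mul_eq_mul_div, div_le_iff₀ hM0]
      nlinarith
    nlinarith
  have h4 : M * ((ε - ε ^ 2 / 2 + (1 - ε) * Real.log (1 - ε)) / a) = -Ier ε r * L := by
    rw [ha, Ier]
    field_simp
  have h5 : M * (J * (a ^ 2 / (1 - ε))) ≤ (K + M) * (r ^ 2 * M ^ 2) / (1 - ε) := by
    have h6 : (M : ℝ) * J ≤ K * L + M := by
      have := mul_le_mul_of_nonneg_left hJ hM0.le
      rw [mul_add, mul_div_cancel₀ _ hM0.ne'] at this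
      linarith
    have h7 : K * L + M ≤ (K + M) * L ^ 2 := by
      have := mul_le_mul_of_nonneg_left (show L ≤ L ^ 2 by nlinarith) hK.le
      have := mul_le_mul_of_nonneg_left (show 1 ≤ L ^ 2 by nlinarith) hM0.le
      linarith
    calc M * (J * (a ^ 2 / (1 - ε))) = M * J * (a ^ 2 / (1 - ε)) := by ring
      _ ≤ (K + M) * L ^ 2 * (a ^ 2 / (1 - ε)) :=
        mul_le_mul_of_nonneg_right (h6.trans h7) (by positivity)
      _ = _ := by rw [ha]; field_simp
  have h8 := mul_le_mul_of_nonneg_left h1 hM0.le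
  linarith

/-- A vertex is good with probability at least `n ^ (b - 1)`, up to a constant, for some
`b > 0`. -/
lemma exists_le_real_largeComponent (hε0 : 0 < ε) (hε1 : ε < 1) (hr : 0 < r)
    (hI : -1 < Ier ε r) : ∃ C > 0, ∃ b > 0, ∀ᶠ n : ℕ in atTop, ∀ v : Fin n,
      C * Real.exp ((b - 1) * Real.log n) ≤
        (bernPi (edgeProb n ((1 - ε) / n) (r / (n * Real.log n)))).real
          (largeComponent ⌈K0 ε r * Real.log n⌉₊ v) := by
  have hb : 0 < (1 + Ier ε r) / 2 := by linarith
  have hK0 : 0 < K0 ε r := one_pos.trans_le one_le_K0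
  set b := (1 + Ier ε r) / 2 with hbdef
  set K := K0 ε r
  obtain ⟨M, hM, hMb⟩ := exists_mul_log_le hK0 hb
  have hM0 : (0 : ℝ) < M := by exact_mod_cast hM
  have hε : 0 < 1 - ε := by linarith
  set A := Real.log (2 * (Real.exp 1 * M)) + M * (-ε - Real.log (1 - ε)) +
      (K + M) * (r ^ 2 * M ^ 2) / (1 - ε) with hA
  refine ⟨1 / 2 * ((1 - ε) ^ M * Real.exp (-(1 - ε)) / M.factorial) * Real.exp (-A),
    by positivity, b, hb, ?_⟩
  filter_upwards [eventually_le_stepProb hε0 hε1 hr M,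
    tendsto_log_nat.eventually_ge_atTop (max r (K + 2 * M + 2)), eventually_ge_atTop 1,
    tendsto_log_sq_div_nat.eventually (gt_mem_nhds one_pos)]
    with n hstep hLr hn1 hLn v
  set L := Real.log n with hL
  have hrL : r ≤ L := (le_max_left _ _).trans hLr
  have hKL : K + 2 * M + 2 ≤ L := (le_max_right _ _).trans hLr
  have hL1 : 1 ≤ L := by linarith
  have hL0 : 0 < L := by linarith
  have hn0 : (0 : ℝ) < n := by exact_mod_cast hn1
  have hLn' : L ^ 2 ≤ n := by rw [div_lt_one hn0] at hLn; exact hLn.le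
  have h₂ : (1 - ε) / n ∈ Set.Icc (0 : ℝ) 1 := by
    have : (1 : ℝ) ≤ n := by exact_mod_cast hn1
    refine ⟨by positivity, ?_⟩
    rw [div_le_one hn0]
    linarith
  have h₃ : r / (n * L) ∈ Set.Icc (0 : ℝ) 1 := by
    have : (1 : ℝ) ≤ n := by exact_mod_cast hn1
    refine ⟨by positivity, ?_⟩
    rw [div_le_one (by positivity)]
    nlinarith
  set J := ⌈K * L / M⌉₊ with hJ
  set c : ℕ → ℕ := fun l => M * min l ⌊ε / (r * M / L)⌋₊ with hc
  have hJle : (J : ℝ) ≤ K * L / M + 1 := (Nat.ceil_lt_add_one (by positivity)).le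
  have hJge : K * L ≤ J * M := by
    have := Nat.le_ceil (K * L / M)
    rwa [div_le_iff₀ hM0] at this
  have hkJ : ⌈K * L⌉₊ ≤ 1 + (J + 1) * M := by
    have : ⌈K * L⌉₊ ≤ J * M := Nat.ceil_le.2 (by exact_mod_cast hJge)
    nlinarith
  have hcl : ∀ l, c l ≤ 1 + l * M := by
    intro l
    have := Nat.mul_le_mul_left M (min_le_left l ⌊ε / (r * M / L)⌋₊)
    simp only [hc]
    nlinarith
  have hlam1 : ∀ l, 1 - ε + c l * r / L ≤ 1 := by
    intro l
    have h1 : ((min l ⌊ε / (r * M / L)⌋₊ : ℕ) : ℝ) ≤ ε / (r * M / L) :=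
      (Nat.cast_le.2 (min_le_right _ _)).trans (Nat.floor_le (by positivity))
    rw [le_div_iff₀ (by positivity)] at h1
    have h2 : (c l : ℝ) * r / L = (min l ⌊ε / (r * M / L)⌋₊ : ℕ) * (r * M / L) := by
      simp only [hc]
      push_cast
      ring
    linarith
  refine le_trans ?_ (le_real_largeComponent h₂ h₃ hcl hkJ v)
  have hfirst : 1 / 2 * ((1 - ε) ^ M * Real.exp (-(1 - ε)) / M.factorial) ≤
      stepProb ((1 - ε) / n) (r / (n * L)) (n - 1) M 1 0 := by
    have := hstep (n - 1) 1 0 hM (Nat.sub_le _ _)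
      (by rw [Nat.cast_sub hn1]; push_cast; nlinarith) (by simpa using hε0.le)
    simpa using this
  have hsteps : ∀ l ∈ Finset.range J, 1 / (2 * (Real.exp 1 * M)) *
      Real.exp (-(M * (1 - ε + c l * r / L - 1 - Real.log (1 - ε + c l * r / L)))) ≤
      stepProb ((1 - ε) / n) (r / (n * L)) (n - (1 + (l + 1) * M)) M M (c l) := by
    intro l hl
    have hlJ : (l : ℝ) + 1 ≤ J := by exact_mod_cast Finset.mem_range.1 hl
    have hsize : (1 : ℝ) + (l + 1) * M ≤ L ^ 2 := by
      have h1 : (l + 1 : ℝ) * M ≤ (K * L / M + 1) * M := by gcongr; linarith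
      rw [show (K * L / M + 1) * M = K * L + M by field_simp] at h1
      nlinarith
    have hsize' : 1 + (l + 1) * M ≤ n := by exact_mod_cast hsize.trans hLn'
    have h1 := hstep (n - (1 + (l + 1) * M)) M (c l) le_rfl (Nat.sub_le _ _)
      (by rw [Nat.cast_sub hsize']; push_cast; linarith) (hlam1 l)
    refine le_trans ?_ h1
    have h2 := exp_neg_le_poisson hM (lam := 1 - ε + c l * r / L) (by positivity)
    have h3 : 1 / (2 * (Real.exp 1 * M)) = 1 / 2 * (1 / (Real.exp 1 * (M : ℝ))) := by
      field_simp
    rw [h3, mul_assoc]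
    gcongr
  have hprod : Real.exp (-A) * Real.exp ((b - 1) * L) ≤
      ∏ l ∈ Finset.range J, stepProb ((1 - ε) / n) (r / (n * L)) (n - (1 + (l + 1) * M)) M M
        (c l) := by
    refine le_trans ?_ (Finset.prod_le_prod (fun l _ => by positivity) hsteps)
    rw [Finset.prod_mul_distrib, Finset.prod_const, Finset.card_range, ← Real.exp_sum,
      Finset.sum_neg_distrib, ← Finset.mul_sum,
      ← Real.exp_log (show 0 < 1 / (2 * (Real.exp 1 * (M : ℝ))) by positivity),
      ← Real.exp_nat_mul, ← Real.exp_add, ← Real.exp_add, Real.exp_le_exp, one_div, Real.log_inv]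
    have := exponent_le hε0 hε1 hr hM hL1 hK0 hMb hJle
    have hbI : b - Ier ε r = 1 - b := by rw [hbdef]; ring
    rw [hbI, ← hA] at this
    simp only [hc]
    linarith
  rw [mul_assoc]
  have := stepProb_nonneg h₂ h₃ (n - 1) M 1 0
  gcongr

end LowerBound

/-! ### Concentration of the number of good vertices -/

section SecondMoment

lemma integral_sum_indicator {Ω ι : Type*} [MeasurableSpace Ω] [Finite Ω]
    [MeasurableSingletonClass Ω] [Fintype ι] (μ : Measure Ω) [IsFiniteMeasure μ]
    (A : ι → Set Ω) :
    ∫ ω, ∑ i, (A i).indicator (1 : Ω → ℝ) ω ∂μ = ∑ i, μ.real (A i) := by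
  rw [integral_finsetSum _ fun _ _ => Integrable.of_finite]
  exact Finset.sum_congr rfl fun i _ => integral_indicator_one (Set.toFinite _).measurableSet

lemma integral_sum_indicator_sq {Ω ι : Type*} [MeasurableSpace Ω] [Finite Ω]
    [MeasurableSingletonClass Ω] [Fintype ι] (μ : Measure Ω) [IsFiniteMeasure μ]
    (A : ι → Set Ω) :
    ∫ ω, (∑ i, (A i).indicator (1 : Ω → ℝ) ω) ^ 2 ∂μ = ∑ i, ∑ j, μ.real (A i ∩ A j) := by
  have h : ∀ ω, (∑ i, (A i).indicator (1 : Ω → ℝ) ω) ^ 2 =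
      ∑ p : ι × ι, (A p.1 ∩ A p.2).indicator (1 : Ω → ℝ) ω := by
    intro ω
    rw [sq, Finset.sum_mul_sum, Fintype.sum_prod_type]
    simp only [Set.inter_indicator_one, Pi.mul_apply]
  simp only [h]
  rw [integral_sum_indicator μ (fun p : ι × ι => A p.1 ∩ A p.2), Fintype.sum_prod_type]

lemma sq_sum_real_le {Ω ι : Type*} [MeasurableSpace Ω] [Finite Ω]
    [MeasurableSingletonClass Ω] [Fintype ι] (μ : Measure Ω) [IsProbabilityMeasure μ]
    (A : ι → Set Ω) :
    (∑ i, μ.real (A i)) ^ 2 ≤ ∑ i, ∑ j, μ.real (A i ∩ A j) := by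
  rw [← integral_sum_indicator, ← integral_sum_indicator_sq]
  set X : Ω → ℝ := fun ω => ∑ i, (A i).indicator (1 : Ω → ℝ) ω
  have hX : MemLp X 2 μ :=
    (memLp_two_iff_integrable_sq Integrable.of_finite.aestronglyMeasurable).2 Integrable.of_finite
  have h := variance_eq_sub hX
  have h0 := variance_nonneg X μ
  simp only [Pi.pow_apply] at h
  linarith

variable {n : ℕ} {ε r : ℝ}

lemma goodCount_eq_sum (ω : EdgeIdx n → Bool) :
    (goodCount n ε r ω : ℝ) =
      ∑ v, (largeComponent ⌈K0 ε r * Real.log n⌉₊ v).indicator (1 : (EdgeIdx n → Bool) → ℝ) ω := by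
  classical
  rw [goodCount, Set.ncard_eq_toFinset_card', Finset.card_eq_sum_ones, Nat.cast_sum]
  simp only [Set.toFinset_ofPred, Finset.sum_filter, Set.indicator_apply, largeComponent,
    Set.mem_ofPred_eq, propComponent_singleton, Set.ncard_coe_finset, Nat.ceil_le, Pi.one_apply,
    Nat.cast_one]

lemma lintegral_goodCount_pow (m : ℕ) [IsFiniteMeasure (hypMeasure n ε r)] :
    ∫⁻ ω, (goodCount n ε r ω : ℝ≥0∞) ^ m ∂(hypMeasure n ε r) =
      ENNReal.ofReal (∫ ω, (goodCount n ε r ω : ℝ) ^ m ∂(hypMeasure n ε r)) := by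
  rw [ofReal_integral_eq_lintegral_ofReal Integrable.of_finite
    (Eventually.of_forall fun ω => by positivity)]
  refine lintegral_congr fun ω => ?_
  rw [ENNReal.ofReal_pow (Nat.cast_nonneg _), ENNReal.ofReal_natCast]

/-- The ratio of moments, sandwiched between `1` and `1` plus an error term. -/
lemma second_moment_sandwich (hε0 : 0 < ε) (hε1 : ε < 1) (hr : 0 < r) (hn : 1 ≤ n)
    (hL : 1 ≤ Real.log n) (hrL : r ≤ Real.log n) {k : ℕ} (hk : k = ⌈K0 ε r * Real.log n⌉₊)
    {E : ℝ} (hE : E = ∑ v, (hypMeasure n ε r).real (largeComponent k v)) (hE0 : 0 < E) :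
    ∃ ρ : ℝ, (∫⁻ ω, (goodCount n ε r ω : ℝ≥0∞) ^ 2 ∂(hypMeasure n ε r)) /
          (∫⁻ ω, (goodCount n ε r ω : ℝ≥0∞) ∂(hypMeasure n ε r)) ^ 2 = ENNReal.ofReal ρ ∧
      1 ≤ ρ ∧ ρ ≤ 1 + (k + k ^ 2 + k ^ 3 * r) / E := by
  have hn0 : (0 : ℝ) < n := by exact_mod_cast hn
  have hn1 : (1 : ℝ) ≤ n := by exact_mod_cast hn
  have hL0 : 0 < Real.log n := by linarith
  have h₂ : (1 - ε) / n ∈ Set.Icc (0 : ℝ) 1 := by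
    refine ⟨div_nonneg (by linarith) hn0.le, ?_⟩
    rw [div_le_one hn0]
    linarith
  have h₃ : r / (n * Real.log n) ∈ Set.Icc (0 : ℝ) 1 := by
    refine ⟨by positivity, ?_⟩
    rw [div_le_one (by positivity)]
    nlinarith
  have hprob : IsProbabilityMeasure (hypMeasure n ε r) :=
    isProbabilityMeasure_bernPi fun e => edgeProb_mem_Icc h₂ h₃ e
  have hk1 : 1 ≤ k := by
    rw [hk, Nat.one_le_ceil_iff]
    exact mul_pos (one_pos.trans_le one_le_K0) hL0
  set S := ∑ u, ∑ v, (hypMeasure n ε r).real (largeComponent k u ∩ largeComponent k v) with hS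
  have h1 : ∫⁻ ω, (goodCount n ε r ω : ℝ≥0∞) ∂(hypMeasure n ε r) = ENNReal.ofReal E := by
    have := lintegral_goodCount_pow (n := n) (ε := ε) (r := r) 1
    simp only [pow_one, goodCount_eq_sum] at this
    rw [this, integral_sum_indicator, hE, hk]
  have h2 : ∫⁻ ω, (goodCount n ε r ω : ℝ≥0∞) ^ 2 ∂(hypMeasure n ε r) = ENNReal.ofReal S := by
    rw [lintegral_goodCount_pow]
    simp only [goodCount_eq_sum]
    rw [integral_sum_indicator_sq, hS, hk]
  refine ⟨S / E ^ 2, ?_, ?_, ?_⟩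
  · rw [h1, h2, ← ENNReal.ofReal_pow hE0.le, ENNReal.ofReal_div_of_pos (by positivity)]
  · rw [one_le_div (by positivity), hE]
    exact sq_sum_real_le _ _
  · have h3 : S ≤ E * (k + E + n * (k ^ 2 * ((1 - ε) / n) + k ^ 3 * (r / (n * Real.log n)))) := by
      rw [hE, Finset.sum_mul, hS]
      exact Finset.sum_le_sum fun u _ => sum_real_largeComponent_inter_le h₂ h₃ hk1 u
    have h4 : n * (k ^ 2 * ((1 - ε) / n) + k ^ 3 * (r / (n * Real.log n))) ≤
        (k : ℝ) ^ 2 + k ^ 3 * r := by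
      have h5 : n * (k ^ 2 * ((1 - ε) / n) + k ^ 3 * (r / (n * Real.log n))) =
          (k : ℝ) ^ 2 * (1 - ε) + k ^ 3 * (r / Real.log n) := by field_simp
      rw [h5]
      have : r / Real.log n ≤ r := div_le_self hr.le hL
      have : (k : ℝ) ^ 2 * (1 - ε) ≤ k ^ 2 := mul_le_of_le_one_right (by positivity) (by linarith)
      gcongr
    have h6 : 1 + (k + k ^ 2 + k ^ 3 * r) / E = E * (k + E + (k ^ 2 + k ^ 3 * r)) / E ^ 2 := by
      field_simp
      ring
    rw [h6]
    gcongr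
    refine h3.trans ?_
    gcongr

lemma tendsto_log_cube_mul_exp {b : ℝ} (hb : 0 < b) (D : ℝ) :
    Tendsto (fun n : ℕ => D * (Real.log n) ^ 3 * Real.exp (-b * Real.log n)) atTop (nhds 0) := by
  have h := (tendsto_rpow_mul_exp_neg_mul_atTop_nhds_zero 3 b hb).comp tendsto_log_nat
  have h' := h.const_mul D
  rw [mul_zero] at h'
  refine h'.congr fun n => ?_
  simp only [Function.comp_apply]
  rw [← Real.rpow_natCast, mul_assoc]
  norm_num

/-- The error term of the second moment, in terms of a lower bound for the first moment. -/
lemma error_le {C b L E : ℝ} {k : ℕ} (hr : 0 < r) (hC : 0 < C) (hL : 1 ≤ L)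
    (hk : k = ⌈K0 ε r * L⌉₊) (hE : C * Real.exp (b * L) ≤ E) :
    (k + k ^ 2 + k ^ 3 * r) / E ≤
      (2 + r) * (K0 ε r + 1) ^ 3 / C * L ^ 3 * Real.exp (-b * L) := by
  have hK : 1 ≤ K0 ε r := one_le_K0
  have hk0 : (1 : ℝ) ≤ k := by
    have : 1 ≤ k := by
      rw [hk, Nat.one_le_ceil_iff]
      positivity
    exact_mod_cast this
  have hkL : (k : ℝ) ≤ (K0 ε r + 1) * L := by
    have := (Nat.ceil_lt_add_one (show 0 ≤ K0 ε r * L by positivity)).le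
    rw [← hk] at this
    linarith
  have h1 : (k : ℝ) + k ^ 2 + k ^ 3 * r ≤ (2 + r) * k ^ 3 := by
    have := pow_le_pow_right₀ hk0 (show 2 ≤ 3 by norm_num)
    have := le_self_pow₀ hk0 (show 3 ≠ 0 by norm_num)
    linarith
  calc _ ≤ (2 + r) * ((K0 ε r + 1) * L) ^ 3 / (C * Real.exp (b * L)) := by
        gcongr
        refine h1.trans ?_
        gcongr
    _ = _ := by
        rw [neg_mul, Real.exp_neg, mul_pow]
        field_simp

end SecondMoment

/-- If `I_{ε,r} > -1` then `E[X²] = (1+o(1)) E[X]²` for the number `X` of good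
vertices: the ratio `E[X²]/E[X]²` tends to `1`. -/
theorem second_moment_good_count (ε r : ℝ) (hε0 : 0 < ε) (hε1 : ε < 1) (hr : 0 < r)
    (hI : -1 < Ier ε r) :
    Tendsto
      (fun n : ℕ =>
        (∫⁻ ω, (goodCount n ε r ω : ℝ≥0∞) ^ 2 ∂(hypMeasure n ε r)) /
          (∫⁻ ω, (goodCount n ε r ω : ℝ≥0∞) ∂(hypMeasure n ε r)) ^ 2)
      atTop (nhds 1) := by
  obtain ⟨C, hC, b, hb, hlow⟩ := exists_le_real_largeComponent hε0 hε1 hr hI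
  have hev : ∀ᶠ n : ℕ in atTop, ∃ ρ : ℝ,
      (∫⁻ ω, (goodCount n ε r ω : ℝ≥0∞) ^ 2 ∂(hypMeasure n ε r)) /
        (∫⁻ ω, (goodCount n ε r ω : ℝ≥0∞) ∂(hypMeasure n ε r)) ^ 2 = ENNReal.ofReal ρ ∧
      1 ≤ ρ ∧ ρ ≤ 1 + (2 + r) * (K0 ε r + 1) ^ 3 / C * Real.log n ^ 3 *
        Real.exp (-b * Real.log n) := by
    filter_upwards [hlow, tendsto_log_nat.eventually_ge_atTop (max r 1),
      eventually_ge_atTop 1] with n hlow hL hn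
    have hL1 : 1 ≤ Real.log n := (le_max_right _ _).trans hL
    have hn0 : (0 : ℝ) < n := by exact_mod_cast hn
    have hE : C * Real.exp (b * Real.log n) ≤
        ∑ v, (hypMeasure n ε r).real (largeComponent ⌈K0 ε r * Real.log n⌉₊ v) := by
      have h := Finset.sum_le_sum fun (v : Fin n) (_ : v ∈ Finset.univ) => hlow v
      rw [Finset.sum_const, Finset.card_univ, Fintype.card_fin, nsmul_eq_mul] at h
      refine le_trans (le_of_eq ?_) h
      rw [sub_mul, one_mul, Real.exp_sub, Real.exp_log hn0]
      field_simp
    obtain ⟨ρ, hρ, h1, h2⟩ := second_moment_sandwich hε0 hε1 hr hn hL1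
      ((le_max_left _ _).trans hL) rfl rfl (lt_of_lt_of_le (by positivity) hE)
    exact ⟨ρ, hρ, h1, h2.trans (by gcongr; exact error_le hr hC hL1 rfl hE)⟩
  have hlim : Tendsto (fun n : ℕ => ENNReal.ofReal (1 + (2 + r) * (K0 ε r + 1) ^ 3 / C *
      Real.log n ^ 3 * Real.exp (-b * Real.log n))) atTop (nhds 1) := by
    have h := ENNReal.tendsto_ofReal
      ((tendsto_log_cube_mul_exp hb ((2 + r) * (K0 ε r + 1) ^ 3 / C)).const_add 1)
    simpa using h
  refine tendsto_of_tendsto_of_tendsto_of_le_of_le' tendsto_const_nhds hlim ?_ ?_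
  · filter_upwards [hev] with n ⟨ρ, hρ, h1, _⟩
    rw [hρ]
    exact ENNReal.one_le_ofReal.2 h1
  · filter_upwards [hev] with n ⟨ρ, hρ, _, h2⟩
    rw [hρ]
    exact ENNReal.ofReal_le_ofReal h2
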